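/- arXiv:1811.08089 — 10 statements merged into one kernel-verified Lean document; each statement's English description precedes it below -/
import Mathlib

section
/- Let (S^A, S^B) be a pair of finite orthonormal families of vectors in a finite-dimensional complex inner product space H, with |S^A| ≥ 2 and |S^B| ≥ 2. The following three conditions are equivalent: (1) (S^A, S^B) is perfectly distinguishable by post-processing; (2) there exists a standard pair (Φ^A_a)_{a∈K_A}, (Φ^B_b)_{b∈K_B} such that ⟨φ^A_a, φ^B_b⟩ = ⟨Φ^A_a, Φ^B_b⟩ for all (a,b) ∈ K_A × K_B; (3) the matrix P with entries P_{ab} = |⟨φ^A_a, φ^B_b⟩|² belongs to D̄(|S^A|, |S^B|). -/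
open scoped Classical

notation "⟪" x ", " y "⟫_ℂ" => @inner ℂ _ _ x y

noncomputable section

/-- A POVM over a finite index type `Ω`: a family of positive semidefinite operators
on `H` summing to the identity. -/
def IsPOVM {H : Type*} [NormedAddCommGroup H] [InnerProductSpace ℂ H]
    {Ω : Type*} [Fintype Ω] (M : Ω → H →ₗ[ℂ] H) : Prop :=
  (∀ ω x, 0 ≤ (⟪x, M ω x⟫_ℂ).re ∧ (⟪x, M ω x⟫_ℂ).im = 0) ∧
    ∑ ω, M ω = LinearMap.id

/-- `(φA, φB)` is perfectly distinguishable by post-processing. -/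
def PerfectlyDistinguishable {H : Type*} [NormedAddCommGroup H] [InnerProductSpace ℂ H]
    {KA KB : Type*} [Fintype KA] [Fintype KB] (φA : KA → H) (φB : KB → H) : Prop :=
  ∃ (N : ℕ) (M : Fin N → H →ₗ[ℂ] H) (fA : Fin N → KA) (fB : Fin N → KB),
    IsPOVM M ∧
    (∀ a, ∑ ω ∈ Finset.univ.filter (fun ω => fA ω = a), ⟪φA a, M ω (φA a)⟫_ℂ = 1) ∧
    (∀ b, ∑ ω ∈ Finset.univ.filter (fun ω => fB ω = b), ⟪φB b, M ω (φB b)⟫_ℂ = 1)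

/-- A standard pair in `ℂ^{K_A × K_B}`. -/
def IsStandardPair {KA KB : Type*} [Fintype KA] [Fintype KB]
    (ΦA : KA → EuclideanSpace ℂ (KA × KB)) (ΦB : KB → EuclideanSpace ℂ (KA × KB)) : Prop :=
  ∃ (α β : KA → KB → ℂ),
    (∀ a, ∑ b, ‖α a b‖ ^ 2 = 1) ∧ (∀ b, ∑ a, ‖β a b‖ ^ 2 = 1) ∧
    (∀ a, ΦA a = ∑ b, α a b • EuclideanSpace.single (a, b) (1 : ℂ)) ∧
    (∀ b, ΦB b = ∑ a, β a b • EuclideanSpace.single (a, b) (1 : ℂ))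

/-- Right stochastic matrix: nonnegative entries, rows sum to 1. -/
def RightStochastic {n m : Type*} [Fintype m] (A : Matrix n m ℝ) : Prop :=
  (∀ i j, 0 ≤ A i j) ∧ ∀ i, ∑ j, A i j = 1

/-- Left stochastic matrix: nonnegative entries, columns sum to 1. -/
def LeftStochastic {n m : Type*} [Fintype n] (B : Matrix n m ℝ) : Prop :=
  (∀ i j, 0 ≤ B i j) ∧ ∀ j, ∑ i, B i j = 1

/-- Membership in `D̄(n,m)`: decomposable into an entrywise product of a right
stochastic matrix and a left stochastic matrix. -/
def MemDBar {n m : Type*} [Fintype n] [Fintype m] (P : Matrix n m ℝ) : Prop :=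
  ∃ A B : Matrix n m ℝ, RightStochastic A ∧ LeftStochastic B ∧ ∀ i j, P i j = A i j * B i j

/-- Membership in `D(n,m)`: members of `D̄(n,m)` with all entries strictly positive. -/
def MemD {n m : Type*} [Fintype n] [Fintype m] (P : Matrix n m ℝ) : Prop :=
  MemDBar P ∧ ∀ i j, 0 < P i j

/-- A measurement table for `(φA, φB)`. -/
def IsMeasurementTable {H : Type*} [NormedAddCommGroup H] [InnerProductSpace ℂ H]
    {KA KB : Type*} [Fintype KA] [Fintype KB]
    (φA : KA → H) (φB : KB → H) (M : KA × KB → H →ₗ[ℂ] H) : Prop :=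
  IsPOVM M ∧
    (∀ a, ∑ b, ⟪φA a, M (a, b) (φA a)⟫_ℂ = 1) ∧
    (∀ b, ∑ a, ⟪φB b, M (a, b) (φB b)⟫_ℂ = 1)


section Stochastic

variable {n m : Type*}

theorem mul_div_bounds {a b s : ℝ} (ha : 0 ≤ a) (hb : 0 ≤ b) (has : a ≤ s) :
    0 ≤ a * b / s ∧ a * b / s ≤ b ∧ s * (a * b / s) = a * b := by
  rcases ha.eq_or_lt with rfl | ha
  · simpa using hb
  · have hs : 0 < s := ha.trans_le has
    refine ⟨by positivity, ?_, by field_simp⟩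
    rw [div_le_iff₀ hs, mul_comm b]
    gcongr

theorem continuousOn_mul_div {a b : ℝ} {s : ℝ → ℝ} {S : Set ℝ} (ha : 0 ≤ a)
    (hs : ContinuousOn s S) (has : ∀ x ∈ S, a ≤ s x) :
    ContinuousOn (fun x => a * b / s x) S := by
  rcases ha.eq_or_lt with rfl | ha
  · simpa using continuousOn_const
  · exact continuousOn_const.div hs fun x hx => (ha.trans_le (has x hx)).ne'

/-- Lowering one entry of a `2 × 2` block of a Hadamard product by moving mass cyclically within
the two rows of the first factor and the two columns of the second factor. -/
theorem exists_cyclic_shift {a₁ a₂ a₃ a₄ b₁ b₂ b₃ b₄ t : ℝ}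
    (ha₁ : 0 ≤ a₁) (ha₂ : 0 ≤ a₂) (ha₃ : 0 ≤ a₃) (ha₄ : 0 ≤ a₄)
    (hb₂ : 0 ≤ b₂) (hb₃ : 0 ≤ b₃) (hb₄ : 0 ≤ b₄)
    (ht : 0 ≤ t) (hta : t ≤ a₁ * b₁) :
    ∃ x y u w : ℝ, (0 ≤ x ∧ x ≤ a₁) ∧ (0 ≤ y ∧ y ≤ a₃) ∧ (0 ≤ u ∧ u ≤ b₂) ∧ (0 ≤ w ∧ w ≤ b₄) ∧
      (a₁ + a₂ - x) * u = a₂ * b₂ ∧ y * (b₂ + b₃ - u) = a₃ * b₃ ∧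
      (a₃ + a₄ - y) * w = a₄ * b₄ ∧ x * (b₄ + b₁ - w) = t := by
  let u : ℝ → ℝ := fun x => a₂ * b₂ / (a₁ + a₂ - x)
  let y : ℝ → ℝ := fun x => b₃ * a₃ / (b₂ + b₃ - u x)
  let w : ℝ → ℝ := fun x => a₄ * b₄ / (a₃ + a₄ - y x)
  have hu (x : ℝ) (hx : x ∈ Set.Icc 0 a₁) :=
    mul_div_bounds (s := a₁ + a₂ - x) ha₂ hb₂ (by linarith [hx.2])
  have hy (x : ℝ) (hx : x ∈ Set.Icc 0 a₁) :=
    mul_div_bounds (s := b₂ + b₃ - u x) hb₃ ha₃ (by linarith [(hu x hx).2.1])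
  have hw (x : ℝ) (hx : x ∈ Set.Icc 0 a₁) :=
    mul_div_bounds (s := a₃ + a₄ - y x) ha₄ hb₄ (by linarith [(hy x hx).2.1])
  have cu : ContinuousOn u (Set.Icc 0 a₁) :=
    continuousOn_mul_div ha₂ (by fun_prop) fun x hx => by linarith [hx.2]
  have cy : ContinuousOn y (Set.Icc 0 a₁) :=
    continuousOn_mul_div hb₃ (by fun_prop) fun x hx => by linarith [(hu x hx).2.1]
  have cw : ContinuousOn w (Set.Icc 0 a₁) :=
    continuousOn_mul_div ha₄ (by fun_prop) fun x hx => by linarith [(hy x hx).2.1]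
  have hmem : a₁ ∈ Set.Icc 0 a₁ := ⟨ha₁, le_rfl⟩
  have hend : t ≤ a₁ * (b₄ + b₁ - w a₁) :=
    hta.trans (mul_le_mul_of_nonneg_left (by linarith [(hw a₁ hmem).2.1]) ha₁)
  obtain ⟨x, hx, hxt⟩ := intermediate_value_Icc (f := fun x => x * (b₄ + b₁ - w x)) ha₁
    (by fun_prop) ⟨by simpa using ht, hend⟩
  refine ⟨x, y x, u x, w x, hx, ⟨(hy x hx).1, (hy x hx).2.1⟩, ⟨(hu x hx).1, (hu x hx).2.1⟩,
    ⟨(hw x hx).1, (hw x hx).2.1⟩, (hu x hx).2.2, ?_, (hw x hx).2.2, hxt⟩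
  rw [mul_comm, mul_comm a₃]
  exact (hy x hx).2.2

/-- Replace the value of `f` at `j` by `x`, compensating at `j'`. -/
def shiftMass (f : m → ℝ) (j j' : m) (x : ℝ) : m → ℝ :=
  Function.update (Function.update f j' (f j + f j' - x)) j x

theorem sum_shiftMass [Fintype m] (f : m → ℝ) {j j' : m} (h : j ≠ j') (x : ℝ) :
    ∑ l, shiftMass f j j' x l = ∑ l, f l := by
  have hd : (Finset.univ \ {j} : Finset m) \ {j'} = Finset.univ \ {j, j'} := by
    ext; simp
  have hj' : j' ∈ (Finset.univ \ {j} : Finset m) := by simp [h.symm]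
  rw [shiftMass, Finset.sum_update_of_mem (Finset.mem_univ j), Finset.sum_update_of_mem hj',
    ← Finset.sum_sdiff (Finset.subset_univ {j, j'}), Finset.sum_pair h, hd]
  ring

theorem shiftMass_nonneg {f : m → ℝ} (hf : ∀ l, 0 ≤ f l) (j j' : m) {x : ℝ} (hx : 0 ≤ x)
    (hxf : x ≤ f j) (l : m) : 0 ≤ shiftMass f j j' x l := by
  have := hf j'
  unfold shiftMass
  rcases eq_or_ne l j with rfl | h
  · simpa using hx
  · rcases eq_or_ne l j' with rfl | h'
    · simp only [Function.update_of_ne h, Function.update_self]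
      linarith
    · simpa [Function.update_of_ne h, Function.update_of_ne h'] using hf l

theorem MemDBar.lower_entry [Fintype n] [Fintype m] {P : Matrix n m ℝ} (hP : MemDBar P)
    {i i' : n} {j j' : m} (hi : i ≠ i') (hj : j ≠ j') {t : ℝ} (ht : 0 ≤ t) (htP : t ≤ P i j) :
    MemDBar (fun k l => if k = i ∧ l = j then t else P k l) := by
  obtain ⟨A, B, ⟨hA, hA'⟩, ⟨hB, hB'⟩, hAB⟩ := hP
  obtain ⟨x, y, u, w, hx, hy, hu, hw, h₁, h₂, h₃, h₄⟩ :=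
    exists_cyclic_shift (hA i j) (hA i j') (hA i' j') (hA i' j)
      (hB i j') (hB i' j') (hB i' j) ht (hAB i j ▸ htP)
  let A' : Matrix n m ℝ := fun k => if k = i then shiftMass (A i) j j' x
    else if k = i' then shiftMass (A i') j' j y else A k
  let C : Matrix m n ℝ := fun l => if l = j then shiftMass (fun k => B k j) i' i w
    else if l = j' then shiftMass (fun k => B k j') i i' u else fun k => B k l
  refine ⟨A', fun k l => C l k, ⟨fun k l => ?_, fun k => ?_⟩, ⟨fun k l => ?_, fun l => ?_⟩,
    fun k l => ?_⟩
  · dsimp only [A']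
    split_ifs
    · exact shiftMass_nonneg (hA i) _ _ hx.1 hx.2 l
    · exact shiftMass_nonneg (hA i') _ _ hy.1 hy.2 l
    · exact hA k l
  · dsimp only [A']
    split_ifs
    · rw [sum_shiftMass _ hj, hA']
    · rw [sum_shiftMass _ hj.symm, hA']
    · exact hA' k
  · dsimp only [C]
    split_ifs
    · exact shiftMass_nonneg (fun k => hB k j) _ _ hw.1 hw.2 k
    · exact shiftMass_nonneg (fun k => hB k j') _ _ hu.1 hu.2 k
    · exact hB k l
  · dsimp only [C]
    split_ifs
    · rw [sum_shiftMass _ hi.symm, hB']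
    · rw [sum_shiftMass _ hi, hB']
    · exact hB' l
  · have hk : k = i ∨ k = i' ∨ (k ≠ i ∧ k ≠ i') := by tauto
    have hl : l = j ∨ l = j' ∨ (l ≠ j ∧ l ≠ j') := by tauto
    rcases hk with rfl | rfl | ⟨hk, hk'⟩ <;> rcases hl with rfl | rfl | ⟨hl, hl'⟩ <;>
      simp_all [A', C, shiftMass, Ne.symm]

theorem MemDBar.mono [Fintype n] [Fintype m] [Nontrivial n] [Nontrivial m]
    {P Q : Matrix n m ℝ} (hP : MemDBar P) (hQ : ∀ i j, 0 ≤ Q i j) (hQP : ∀ i j, Q i j ≤ P i j) :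
    MemDBar Q := by
  have key (S : Finset (n × m)) :
      MemDBar (fun k l => if (k, l) ∈ S then Q k l else P k l) := by
    induction S using Finset.induction_on with
    | empty => simpa using hP
    | insert p S hp ih =>
      obtain ⟨i, j⟩ := p
      obtain ⟨i', hi⟩ := exists_ne i
      obtain ⟨j', hj⟩ := exists_ne j
      have := ih.lower_entry hi.symm hj.symm (hQ i j) (by simpa [hp] using hQP i j)
      refine (congrArg MemDBar ?_).mpr this
      ext k l
      by_cases h : k = i ∧ l = j
      · obtain ⟨rfl, rfl⟩ := h
        simp
      · simp [h]
  simpa using key Finset.univ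

end Stochastic

section StandardPair

variable {KA KB : Type*}

theorem sum_smul_single_fst_apply [Fintype KB] (α : KA → KB → ℂ) (a : KA) (p : KA × KB) :
    (∑ b, α a b • EuclideanSpace.single (a, b) (1 : ℂ)) p = if p.1 = a then α a p.2 else 0 := by
  obtain ⟨a', b'⟩ := p
  by_cases h : a' = a <;> simp [WithLp.ofLp_sum, Finset.sum_apply, Pi.single_apply, h]

theorem sum_smul_single_snd_apply [Fintype KA] (β : KA → KB → ℂ) (b : KB) (p : KA × KB) :
    (∑ a, β a b • EuclideanSpace.single (a, b) (1 : ℂ)) p = if p.2 = b then β p.1 b else 0 := by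
  obtain ⟨a', b'⟩ := p
  by_cases h : b' = b <;> simp [WithLp.ofLp_sum, Finset.sum_apply, Pi.single_apply, h]

variable [Fintype KA] [Fintype KB]

theorem inner_standardPair (α β : KA → KB → ℂ) (a : KA) (b : KB) :
    ⟪∑ b, α a b • EuclideanSpace.single (a, b) (1 : ℂ),
      ∑ a, β a b • EuclideanSpace.single (a, b) (1 : ℂ)⟫_ℂ = star (α a b) * β a b := by
  rw [PiLp.inner_apply, Finset.sum_eq_single (a, b)]
  · simp only [sum_smul_single_fst_apply, sum_smul_single_snd_apply]
    simp [mul_comm]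
  · rintro ⟨a', b'⟩ - h
    simp only [sum_smul_single_fst_apply, sum_smul_single_snd_apply]
    by_cases ha : a' = a <;> by_cases hb : b' = b <;> simp_all
  · simp

theorem inner_standard_fst (α : KA → KB → ℂ) (hα : ∀ a, ∑ b, ‖α a b‖ ^ 2 = 1) (a a' : KA) :
    ⟪∑ b, α a b • EuclideanSpace.single (a, b) (1 : ℂ),
      ∑ b, α a' b • EuclideanSpace.single (a', b) (1 : ℂ)⟫_ℂ = if a = a' then 1 else 0 := by
  simp only [PiLp.inner_apply, RCLike.inner_apply, sum_smul_single_fst_apply,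
    Fintype.sum_prod_type_right]
  split_ifs with h
  · subst h
    have := congrArg Complex.ofReal (hα a)
    push_cast at this
    simpa [apply_ite, Complex.mul_conj'] using this
  · simp [Ne.symm h]

theorem inner_standard_snd (β : KA → KB → ℂ) (hβ : ∀ b, ∑ a, ‖β a b‖ ^ 2 = 1) (b b' : KB) :
    ⟪∑ a, β a b • EuclideanSpace.single (a, b) (1 : ℂ),
      ∑ a, β a b' • EuclideanSpace.single (a, b') (1 : ℂ)⟫_ℂ = if b = b' then 1 else 0 := by
  simp only [PiLp.inner_apply, RCLike.inner_apply, sum_smul_single_snd_apply, Fintype.sum_prod_type]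
  split_ifs with h
  · subst h
    have := congrArg Complex.ofReal (hβ b)
    push_cast at this
    simpa [apply_ite, Complex.mul_conj'] using this
  · simp [Ne.symm h]

theorem exists_standardPair_iff_memDBar (G : KA → KB → ℂ) :
    (∃ (ΦA : KA → EuclideanSpace ℂ (KA × KB)) (ΦB : KB → EuclideanSpace ℂ (KA × KB)),
      IsStandardPair ΦA ΦB ∧ ∀ a b, G a b = ⟪ΦA a, ΦB b⟫_ℂ) ↔
    MemDBar (Matrix.of fun a b => ‖G a b‖ ^ 2) := by
  constructor
  · rintro ⟨ΦA, ΦB, ⟨α, β, hα, hβ, hΦA, hΦB⟩, hG⟩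
    refine ⟨fun a b => ‖α a b‖ ^ 2, fun a b => ‖β a b‖ ^ 2, ⟨fun _ _ => by positivity, hα⟩,
      ⟨fun _ _ => by positivity, hβ⟩, fun a b => ?_⟩
    rw [Matrix.of_apply, hG, hΦA, hΦB, inner_standardPair, norm_mul, norm_star, mul_pow]
  · rintro ⟨A, B, ⟨hA, hA'⟩, ⟨hB, hB'⟩, hAB⟩
    have phase (z : ℂ) : ∃ c : ℂ, ‖c‖ = 1 ∧ z = ‖z‖ * c :=
      ⟨Complex.exp (z.arg * Complex.I), Complex.norm_exp_ofReal_mul_I _,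
        (Complex.norm_mul_exp_arg_mul_I z).symm⟩
    choose c hc hc' using phase
    let α (a : KA) (b : KB) : ℂ := √(A a b)
    let β (a : KA) (b : KB) : ℂ := √(B a b) * c (G a b)
    refine ⟨fun a => ∑ b, α a b • EuclideanSpace.single (a, b) (1 : ℂ),
      fun b => ∑ a, β a b • EuclideanSpace.single (a, b) (1 : ℂ), ⟨α, β, ?_, ?_,
      fun _ => rfl, fun _ => rfl⟩, fun a b => ?_⟩
    · intro a
      simpa [α, Real.sq_sqrt (hA _ _)] using hA' a
    · intro b
      simpa [β, hc, Real.sq_sqrt (hB _ _)] using hB' b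
    · have hG : ‖G a b‖ = √(A a b) * √(B a b) := by
        rw [← Real.sqrt_mul (hA a b), ← hAB, Matrix.of_apply, Real.sqrt_sq (norm_nonneg _)]
      rw [inner_standardPair]
      conv_lhs => rw [hc' (G a b), hG]
      simp [α, β, mul_assoc]

end StandardPair

section Operators

variable {H : Type*} [NormedAddCommGroup H] [InnerProductSpace ℂ H]

/-- The Cauchy-Schwarz inequality for the sesquilinear form of a positive operator. -/
theorem LinearMap.IsPositive.norm_inner_sq_le {T : H →ₗ[ℂ] H} (hT : T.IsPositive) (x y : H) :
    ‖⟪x, T y⟫_ℂ‖ ^ 2 ≤ (⟪x, T x⟫_ℂ).re * (⟪y, T y⟫_ℂ).re := by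
  let : PreInnerProductSpace.Core ℂ H :=
    { inner x y := ⟪x, T y⟫_ℂ
      conj_inner_symm x y := by
        change (starRingEnd ℂ) ⟪y, T x⟫_ℂ = ⟪x, T y⟫_ℂ
        rw [inner_conj_symm, hT.isSymmetric]
      re_inner_nonneg x := hT.re_inner_nonneg_right x
      add_left x y z := inner_add_left _ _ _
      smul_left x y r := inner_smul_left _ _ _ }
  have h : ‖⟪x, T y⟫_ℂ‖ * ‖⟪y, T x⟫_ℂ‖ ≤ (⟪x, T x⟫_ℂ).re * (⟪y, T y⟫_ℂ).re :=
    InnerProductSpace.Core.inner_mul_inner_self_le (𝕜 := ℂ) x y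
  rwa [← hT.isSymmetric y x, norm_inner_symm (T y) x, ← sq] at h

theorem IsPOVM.isPositive {Ω : Type*} [Fintype Ω] {M : Ω → H →ₗ[ℂ] H} (hM : IsPOVM M) (ω : Ω) :
    (M ω).IsPositive := by
  rw [LinearMap.isPositive_iff_complex]
  intro x
  obtain ⟨h, h'⟩ := hM.1 ω x
  rw [← inner_conj_symm]
  generalize ⟪x, M ω x⟫_ℂ = z at h h'
  exact ⟨Complex.ext (by simp) (by simp [h']), by simpa using h⟩

theorem IsPOVM.sum_inner {Ω : Type*} [Fintype Ω] {M : Ω → H →ₗ[ℂ] H} (hM : IsPOVM M) (x y : H) :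
    ∑ ω, ⟪x, M ω y⟫_ℂ = ⟪x, y⟫_ℂ := by
  rw [← inner_sum, ← LinearMap.sum_apply, hM.2, LinearMap.id_apply]

theorem IsPOVM.inner_eq_zero_of_sum_eq_one {Ω : Type*} [Fintype Ω] {M : Ω → H →ₗ[ℂ] H}
    (hM : IsPOVM M) {x : H} (hx : ‖x‖ = 1) {S : Finset Ω} (hS : ∑ ω ∈ S, ⟪x, M ω x⟫_ℂ = 1)
    {ω : Ω} (hω : ω ∉ S) : (⟪x, M ω x⟫_ℂ).re = 0 := by
  have htot := hM.sum_inner x x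
  rw [← Finset.sum_add_sum_compl S, hS, inner_self_eq_norm_sq_to_K, hx] at htot
  have h0 : ∑ ω ∈ Sᶜ, (⟪x, M ω x⟫_ℂ).re = 0 := by
    rw [← Complex.re_sum]
    simpa using congrArg Complex.re htot
  exact (Finset.sum_eq_zero_iff_of_nonneg fun ω _ => (hM.1 ω x).1).1 h0 ω (by simpa using hω)

variable {KA KB : Type*} [Fintype KA] [Fintype KB] {φA : KA → H} {φB : KB → H}

theorem PerfectlyDistinguishable.memDBar [Nontrivial KA] [Nontrivial KB]
    (hA : ∀ a, ‖φA a‖ = 1) (hB : ∀ b, ‖φB b‖ = 1) (h : PerfectlyDistinguishable φA φB) :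
    MemDBar (Matrix.of fun a b => ‖⟪φA a, φB b⟫_ℂ‖ ^ 2) := by
  obtain ⟨N, M, fA, fB, hM, hMA, hMB⟩ := h
  let Q (a : KA) (b : KB) : H →ₗ[ℂ] H :=
    ∑ ω ∈ Finset.univ.filter (fun ω => fA ω = a ∧ fB ω = b), M ω
  have hQ (a b) : (Q a b).IsPositive :=
    LinearMap.isPositive_sum _ fun ω _ => hM.isPositive ω
  have hinner (a b) (x y : H) : ⟪x, Q a b y⟫_ℂ =
      ∑ ω ∈ Finset.univ.filter (fun ω => fA ω = a ∧ fB ω = b), ⟪x, M ω y⟫_ℂ := by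
    rw [LinearMap.sum_apply, _root_.inner_sum]
  have hD : MemDBar (Matrix.of fun a b =>
      (⟪φA a, Q a b (φA a)⟫_ℂ).re * (⟪φB b, Q a b (φB b)⟫_ℂ).re) := by
    refine ⟨Matrix.of fun a b => (⟪φA a, Q a b (φA a)⟫_ℂ).re,
      Matrix.of fun a b => (⟪φB b, Q a b (φB b)⟫_ℂ).re,
      ⟨fun a b => (hQ a b).re_inner_nonneg_right _, fun a => ?_⟩,
      ⟨fun a b => (hQ a b).re_inner_nonneg_right _, fun b => ?_⟩, fun a b => rfl⟩
    · have : ∑ b, ⟪φA a, Q a b (φA a)⟫_ℂ = 1 := by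
        simp_rw [hinner, ← Finset.filter_filter]
        exact (Finset.sum_fiberwise _ fB _).trans (hMA a)
      simpa using congrArg Complex.re this
    · have : ∑ a, ⟪φB b, Q a b (φB b)⟫_ℂ = 1 := by
        simp_rw [hinner, and_comm (a := fA _ = _), ← Finset.filter_filter]
        exact (Finset.sum_fiberwise _ fA _).trans (hMB b)
      simpa using congrArg Complex.re this
  refine hD.mono (fun _ _ => sq_nonneg _) fun a b => ?_
  have hab : ⟪φA a, φB b⟫_ℂ = ⟪φA a, Q a b (φB b)⟫_ℂ := by
    rw [hinner, ← hM.sum_inner]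
    refine (Finset.sum_subset (Finset.subset_univ _) fun ω _ hω => ?_).symm
    have hcs := (hM.isPositive ω).norm_inner_sq_le (φA a) (φB b)
    have hzero : (⟪φA a, M ω (φA a)⟫_ℂ).re * (⟪φB b, M ω (φB b)⟫_ℂ).re = 0 := by
      by_cases ha : fA ω = a
      · rw [hM.inner_eq_zero_of_sum_eq_one (hB b) (hMB b) (ω := ω) (by simp_all), mul_zero]
      · rw [hM.inner_eq_zero_of_sum_eq_one (hA a) (hMA a) (ω := ω) (by simp_all), zero_mul]
    rw [hzero] at hcs
    simpa using le_antisymm hcs (sq_nonneg _)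
  rw [Matrix.of_apply, Matrix.of_apply, hab]
  exact (hQ a b).norm_inner_sq_le _ _

theorem perfectlyDistinguishable_of_isPOVM {Ω : Type*} [Fintype Ω] {M : Ω → H →ₗ[ℂ] H}
    (hM : IsPOVM M) (hA : ∀ a, ‖φA a‖ = 1) (hB : ∀ b, ‖φB b‖ = 1) (fA : Ω → KA) (fB : Ω → KB)
    (hfA : ∀ ω a, fA ω ≠ a → ⟪φA a, M ω (φA a)⟫_ℂ = 0)
    (hfB : ∀ ω b, fB ω ≠ b → ⟪φB b, M ω (φB b)⟫_ℂ = 0) : PerfectlyDistinguishable φA φB := by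
  let e := (Fintype.equivFin Ω).symm
  have hMe : IsPOVM fun k => M (e k) :=
    ⟨fun k => hM.1 (e k), (Equiv.sum_comp e M).trans hM.2⟩
  refine ⟨_, _, fA ∘ e, fB ∘ e, hMe, fun a => ?_, fun b => ?_⟩
  · refine (Finset.sum_filter_of_ne fun k _ hk => by_contra fun h => hk (hfA _ a h)).trans ?_
    rw [hMe.sum_inner, inner_self_eq_norm_sq_to_K, hA]
    simp
  · refine (Finset.sum_filter_of_ne fun k _ hk => by_contra fun h => hk (hfB _ b h)).trans ?_
    rw [hMe.sum_inner, inner_self_eq_norm_sq_to_K, hB]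
    simp

variable {E : Type*} [NormedAddCommGroup E] [InnerProductSpace ℂ E]

/-- Two finite families with the same Gram matrix are related by a contraction. -/
theorem exists_contraction_of_gram_eq {ι : Type*} [Fintype ι] (φ : ι → H) (Φ : ι → E)
    (h : ∀ i j, ⟪φ i, φ j⟫_ℂ = ⟪Φ i, Φ j⟫_ℂ) :
    ∃ V : H →ₗ[ℂ] E, (∀ i, V (φ i) = Φ i) ∧ ∀ x, ‖V x‖ ≤ ‖x‖ := by
  let T := Fintype.linearCombination ℂ φ
  let S := Fintype.linearCombination ℂ Φ
  have hTS (c : ι → ℂ) : ‖S c‖ = ‖T c‖ := by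
    have : ⟪S c, S c⟫_ℂ = ⟪T c, T c⟫_ℂ := by
      simp only [S, T, Fintype.linearCombination_apply, _root_.sum_inner, _root_.inner_sum,
        inner_smul_left, inner_smul_right, h]
    rw [inner_self_eq_norm_sq_to_K, inner_self_eq_norm_sq_to_K] at this
    exact (sq_eq_sq₀ (norm_nonneg _) (norm_nonneg _)).1 (by exact_mod_cast this)
  obtain ⟨R, hR⟩ := T.rangeRestrict.exists_rightInverse_of_surjective T.range_rangeRestrict
  have hR' (x : LinearMap.range T) : T (R x) = x :=
    congrArg Subtype.val (LinearMap.congr_fun hR x)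
  let p := (LinearMap.range T).orthogonalProjectionOnto
  refine ⟨S ∘ₗ R ∘ₗ p.toLinearMap, fun i => ?_, fun x => ?_⟩
  · have hT : T (Pi.single i 1) = φ i := by simp [T]
    have hS : S (Pi.single i 1) = Φ i := by simp [S]
    have hp : (p (φ i) : H) = φ i :=
      congrArg Subtype.val <| Submodule.orthogonalProjectionOnto_mem_subspace_eq_self
        (⟨φ i, _, hT⟩ : LinearMap.range T)
    have : ‖S (R (p (φ i)) - Pi.single i 1)‖ = 0 := by
      rw [hTS, map_sub, hR', hp, hT, sub_self, norm_zero]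
    rw [norm_eq_zero, map_sub, hS, sub_eq_zero] at this
    exact this
  · change ‖S (R (p x))‖ ≤ ‖x‖
    rw [hTS, hR']
    exact Submodule.norm_orthogonalProjectionOnto_apply_le _ x

/-- The rank-one operators of the vectors `v ω`, together with their complement. -/
def besselOperators {Ω : Type*} [Fintype Ω] (v : Ω → H) : Option Ω → H →ₗ[ℂ] H
  | none => LinearMap.id - ∑ ω, (InnerProductSpace.rankOne ℂ (v ω) (v ω)).toLinearMap
  | some ω => (InnerProductSpace.rankOne ℂ (v ω) (v ω)).toLinearMap

theorem inner_besselOperators_some {Ω : Type*} [Fintype Ω] (v : Ω → H) (ω : Ω) (x : H) :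
    ⟪x, besselOperators v (some ω) x⟫_ℂ = ((‖⟪v ω, x⟫_ℂ‖ ^ 2 : ℝ) : ℂ) := by
  change ⟪x, ⟪v ω, x⟫_ℂ • v ω⟫_ℂ = _
  rw [inner_smul_right, ← inner_conj_symm x (v ω), Complex.mul_conj', Complex.ofReal_pow]

theorem inner_besselOperators_none {Ω : Type*} [Fintype Ω] (v : Ω → H) (x : H) :
    ⟪x, besselOperators v none x⟫_ℂ = ((‖x‖ ^ 2 - ∑ ω, ‖⟪v ω, x⟫_ℂ‖ ^ 2 : ℝ) : ℂ) := by
  have h : besselOperators v none x = x - ∑ ω, besselOperators v (some ω) x := by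
    simp [besselOperators]
  rw [h, inner_sub_right, _root_.inner_sum, inner_self_eq_norm_sq_to_K]
  simp_rw [inner_besselOperators_some]
  simp

theorem isPOVM_of_bessel {Ω : Type*} [Fintype Ω] (v : Ω → H)
    (hv : ∀ x, ∑ ω, ‖⟪v ω, x⟫_ℂ‖ ^ 2 ≤ ‖x‖ ^ 2) :
    IsPOVM (besselOperators v) := by
  refine ⟨?_, by simp [besselOperators, Fintype.sum_option]⟩
  rintro (_ | ω) x
  · rw [inner_besselOperators_none, Complex.ofReal_re, Complex.ofReal_im]
    exact ⟨sub_nonneg.2 (hv x), rfl⟩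
  · rw [inner_besselOperators_some, Complex.ofReal_re, Complex.ofReal_im]
    exact ⟨sq_nonneg _, rfl⟩

theorem perfectlyDistinguishable_of_standardPair [FiniteDimensional ℂ H] [Nonempty KA] [Nonempty KB]
    (hA : Orthonormal ℂ φA) (hB : Orthonormal ℂ φB)
    {ΦA : KA → EuclideanSpace ℂ (KA × KB)} {ΦB : KB → EuclideanSpace ℂ (KA × KB)}
    (hΦ : IsStandardPair ΦA ΦB) (h : ∀ a b, ⟪φA a, φB b⟫_ℂ = ⟪ΦA a, ΦB b⟫_ℂ) :
    PerfectlyDistinguishable φA φB := by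
  obtain ⟨α, β, hα, hβ, hΦA, hΦB⟩ := hΦ
  have gram (i j : KA ⊕ KB) : ⟪Sum.elim φA φB i, Sum.elim φA φB j⟫_ℂ =
      ⟪Sum.elim ΦA ΦB i, Sum.elim ΦA ΦB j⟫_ℂ := by
    rcases i with a | b <;> rcases j with a' | b'
    · simp only [Sum.elim_inl]
      rw [hΦA, hΦA, inner_standard_fst α hα, orthonormal_iff_ite.1 hA]
    · exact h a b'
    · simp only [Sum.elim_inl, Sum.elim_inr]
      rw [← inner_conj_symm, h, inner_conj_symm]
    · simp only [Sum.elim_inr]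
      rw [hΦB, hΦB, inner_standard_snd β hβ, orthonormal_iff_ite.1 hB]
  obtain ⟨V, hV, hVle⟩ := exists_contraction_of_gram_eq _ _ gram
  let v (p : KA × KB) : H := V.adjoint (EuclideanSpace.single p 1)
  have hv (p : KA × KB) (x : H) : ⟪v p, x⟫_ℂ = V x p := by
    simp [v, LinearMap.adjoint_inner_left, EuclideanSpace.inner_single_left]
  have hsum (x : H) : ∑ p, ‖⟪v p, x⟫_ℂ‖ ^ 2 = ‖V x‖ ^ 2 := by
    simp_rw [hv, EuclideanSpace.norm_sq_eq]
  have hVA (a : KA) : V (φA a) = ΦA a := hV (.inl a)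
  have hVB (b : KB) : V (φB b) = ΦB b := hV (.inr b)
  have hnA (a : KA) : ‖ΦA a‖ = ‖φA a‖ := by
    rw [norm_eq_sqrt_re_inner (𝕜 := ℂ), norm_eq_sqrt_re_inner (𝕜 := ℂ)]
    exact congrArg (fun z => √(RCLike.re z)) (gram (.inl a) (.inl a)).symm
  have hnB (b : KB) : ‖ΦB b‖ = ‖φB b‖ := by
    rw [norm_eq_sqrt_re_inner (𝕜 := ℂ), norm_eq_sqrt_re_inner (𝕜 := ℂ)]
    exact congrArg (fun z => √(RCLike.re z)) (gram (.inr b) (.inr b)).symm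
  have hM := isPOVM_of_bessel v fun x => by
    rw [hsum]
    gcongr
    exact hVle x
  refine perfectlyDistinguishable_of_isPOVM hM hA.1 hB.1
    (fun o => o.elim (Classical.arbitrary KA) Prod.fst)
    (fun o => o.elim (Classical.arbitrary KB) Prod.snd) ?_ ?_
  · rintro (_ | p) a hp
    · rw [inner_besselOperators_none, hsum, hVA, hnA, sub_self, Complex.ofReal_zero]
    · rw [inner_besselOperators_some, hv, hVA, hΦA, sum_smul_single_fst_apply, if_neg (by exact hp)]
      simp
  · rintro (_ | p) b hp
    · rw [inner_besselOperators_none, hsum, hVB, hnB, sub_self, Complex.ofReal_zero]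
    · rw [inner_besselOperators_some, hv, hVB, hΦB, sum_smul_single_snd_apply, if_neg (by exact hp)]
      simp

end Operators

/-- Theorem: for orthonormal families with at least two members each, perfect
distinguishability by post-processing, existence of a standard pair with the same
Gram overlaps, and membership of the overlap matrix in `D̄` are all equivalent. -/
theorem perfect_distinguishability_tfae
    {H : Type*} [NormedAddCommGroup H] [InnerProductSpace ℂ H] [FiniteDimensional ℂ H]
    {KA KB : Type*} [Fintype KA] [Fintype KB]
    (φA : KA → H) (φB : KB → H) (hA : Orthonormal ℂ φA) (hB : Orthonormal ℂ φB)
    (hcA : 2 ≤ Fintype.card KA) (hcB : 2 ≤ Fintype.card KB) :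
    (PerfectlyDistinguishable φA φB ↔
      ∃ (ΦA : KA → EuclideanSpace ℂ (KA × KB)) (ΦB : KB → EuclideanSpace ℂ (KA × KB)),
        IsStandardPair ΦA ΦB ∧ ∀ a b, ⟪φA a, φB b⟫_ℂ = ⟪ΦA a, ΦB b⟫_ℂ) ∧
    (PerfectlyDistinguishable φA φB ↔
      MemDBar (Matrix.of fun a b => ‖⟪φA a, φB b⟫_ℂ‖ ^ 2)) := by
  have : Nontrivial KA := Fintype.one_lt_card_iff_nontrivial.1 hcA
  have : Nontrivial KB := Fintype.one_lt_card_iff_nontrivial.1 hcB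
  have h₁₃ := PerfectlyDistinguishable.memDBar hA.1 hB.1
  have h₃₂ := exists_standardPair_iff_memDBar fun a b => ⟪φA a, φB b⟫_ℂ
  have h₂₁ : (∃ (ΦA : KA → EuclideanSpace ℂ (KA × KB)) (ΦB : KB → EuclideanSpace ℂ (KA × KB)),
      IsStandardPair ΦA ΦB ∧ ∀ a b, ⟪φA a, φB b⟫_ℂ = ⟪ΦA a, ΦB b⟫_ℂ) →
      PerfectlyDistinguishable φA φB :=
    fun ⟨_, _, hΦ, h⟩ => perfectlyDistinguishable_of_standardPair hA hB hΦ h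
  exact ⟨⟨fun h => h₃₂.2 (h₁₃ h), h₂₁⟩, ⟨h₁₃, fun h => h₂₁ (h₃₂.2 h)⟩⟩

end
end

section
/- Let (S^A, S^B) be a pair of finite orthonormal families of vectors in a finite-dimensional complex inner product space H. If (S^A, S^B) is perfectly distinguishable by post-processing, then ∏_{(a,b)∈K_A×K_B} |⟨φ^A_a, φ^B_b⟩|² ≤ (|S^A|·|S^B|)^{−|S^A|·|S^B|}. -/
open scoped Classical

noncomputable section

theorem norm_inner_map_sq_le {H : Type*} [NormedAddCommGroup H] [InnerProductSpace ℂ H]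
    {T : H →ₗ[ℂ] H} (hT : ∀ x, 0 ≤ (⟪x, T x⟫_ℂ).re ∧ (⟪x, T x⟫_ℂ).im = 0) (x y : H) :
    ‖⟪x, T y⟫_ℂ‖ ^ 2 ≤ (⟪x, T x⟫_ℂ).re * (⟪y, T y⟫_ℂ).re := by
  have hs : T.IsSymmetric := by
    rw [LinearMap.isSymmetric_iff_inner_map_self_real]
    intro v
    rw [inner_conj_symm, ← inner_conj_symm (T v) v]
    exact (Complex.conj_eq_iff_im.2 (hT v).2).symm
  let c : PreInnerProductSpace.Core ℂ H :=
    { inner := fun u v => ⟪u, T v⟫_ℂ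
      conj_inner_symm := fun u v => by rw [inner_conj_symm, hs]
      re_inner_nonneg := fun u => (hT u).1
      add_left := fun u v w => inner_add_left u v (T w)
      smul_left := fun u v r => inner_smul_left u (T v) r }
  have h := @InnerProductSpace.Core.inner_mul_inner_self_le ℂ H _ _ _ c x y
  have hn : ‖⟪y, T x⟫_ℂ‖ = ‖⟪x, T y⟫_ℂ‖ := by rw [← hs y x, norm_inner_symm]
  calc ‖⟪x, T y⟫_ℂ‖ ^ 2 = ‖⟪x, T y⟫_ℂ‖ * ‖⟪y, T x⟫_ℂ‖ := by rw [hn, sq]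
    _ ≤ _ := h

theorem prod_le_inv_card_pow_of_sum_eq_one {ι : Type*} [Fintype ι] {x : ι → ℝ}
    (hx : ∀ i, 0 ≤ x i) (hsum : ∑ i, x i = 1) :
    ∏ i, x i ≤ (1 / (Fintype.card ι : ℝ)) ^ Fintype.card ι := by
  rcases isEmpty_or_nonempty ι with _ | _
  · simp at hsum
  have hc : (Fintype.card ι : ℝ) ≠ 0 := Nat.cast_ne_zero.2 Fintype.card_ne_zero
  have h := Real.geom_mean_le_arith_mean_weighted Finset.univ
    (fun _ : ι => (Fintype.card ι : ℝ)⁻¹) x (fun _ _ => by positivity)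
    (by simp [hc]) (fun i _ => hx i)
  rw [← Finset.mul_sum, hsum, mul_one] at h
  calc ∏ i, x i = (∏ i, x i ^ (Fintype.card ι : ℝ)⁻¹) ^ Fintype.card ι := by
        rw [← Finset.prod_pow]
        exact Finset.prod_congr rfl fun i _ =>
          (Real.rpow_inv_natCast_pow (hx i) Fintype.card_ne_zero).symm
    _ ≤ _ := by
        rw [one_div]
        exact pow_le_pow_left₀ (Finset.prod_nonneg fun i _ => Real.rpow_nonneg (hx i) _) h _

/-- If the outcomes labelled `a` exhaust the probability of a state, the state vector is
annihilated, in the sense of the sesquilinear forms, by every other outcome. -/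
theorem IsPOVM.re_inner_eq_zero_of_ne {H : Type*} [NormedAddCommGroup H] [InnerProductSpace ℂ H]
    {Ω K : Type*} [Fintype Ω] {M : Ω → H →ₗ[ℂ] H} (hM : IsPOVM M) {f : Ω → K} {a : K} {x : H}
    (hx : ‖x‖ = 1)
    (h : ∑ ω ∈ Finset.univ.filter (fun ω => f ω = a), ⟪x, M ω x⟫_ℂ = 1) {ω : Ω}
    (hω : f ω ≠ a) : (⟪x, M ω x⟫_ℂ).re = 0 := by
  have htot : ∑ ω, ⟪x, M ω x⟫_ℂ = 1 := by
    rw [← inner_sum, ← LinearMap.sum_apply, hM.2, LinearMap.id_apply,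
      inner_self_eq_norm_sq_to_K, hx]
    simp
  rw [← Finset.sum_filter_add_sum_filter_not Finset.univ (fun ω => f ω = a), h,
    add_eq_left] at htot
  have hre := congrArg Complex.re htot
  rw [Complex.re_sum, Complex.zero_re,
    Finset.sum_eq_zero_iff_of_nonneg fun ω _ => (hM.1 ω x).1] at hre
  exact hre ω (by simpa using hω)

theorem sum_filter_filter_re {Ω K L : Type*} [Fintype Ω] [Fintype L] (f : Ω → K) (g : Ω → L)
    (a : K) (z : Ω → ℂ) (h : ∑ ω ∈ Finset.univ.filter (fun ω => f ω = a), z ω = 1) :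
    ∑ b, ∑ ω ∈ Finset.univ.filter (fun ω => f ω = a ∧ g ω = b), (z ω).re = 1 := by
  have hfib := Finset.sum_fiberwise (Finset.univ.filter fun ω => f ω = a) g fun ω => (z ω).re
  rw [← Complex.re_sum, h, Complex.one_re] at hfib
  simpa only [Finset.filter_filter] using hfib

theorem IsPOVM.norm_inner_sq_le {H : Type*} [NormedAddCommGroup H] [InnerProductSpace ℂ H]
    {Ω K L : Type*} [Fintype Ω] {M : Ω → H →ₗ[ℂ] H} (hM : IsPOVM M) {f : Ω → K} {g : Ω → L}
    {a : K} {b : L} {x y : H} (hx : ‖x‖ = 1) (hy : ‖y‖ = 1)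
    (hf : ∑ ω ∈ Finset.univ.filter (fun ω => f ω = a), ⟪x, M ω x⟫_ℂ = 1)
    (hg : ∑ ω ∈ Finset.univ.filter (fun ω => g ω = b), ⟪y, M ω y⟫_ℂ = 1) :
    ‖⟪x, y⟫_ℂ‖ ^ 2 ≤
      (∑ ω ∈ Finset.univ.filter (fun ω => f ω = a ∧ g ω = b), (⟪x, M ω x⟫_ℂ).re) *
        ∑ ω ∈ Finset.univ.filter (fun ω => f ω = a ∧ g ω = b), (⟪y, M ω y⟫_ℂ).re := by
  have hxy : ⟪x, y⟫_ℂ =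
      ∑ ω ∈ Finset.univ.filter (fun ω => f ω = a ∧ g ω = b), ⟪x, M ω y⟫_ℂ := by
    have h0 : ⟪x, y⟫_ℂ = ∑ ω, ⟪x, M ω y⟫_ℂ := by
      rw [← inner_sum, ← LinearMap.sum_apply, hM.2, LinearMap.id_apply]
    rw [h0]
    refine (Finset.sum_subset (Finset.filter_subset _ _) fun ω _ hω => ?_).symm
    have hle := norm_inner_map_sq_le (hM.1 ω) x y
    have hz : (⟪x, M ω x⟫_ℂ).re * (⟪y, M ω y⟫_ℂ).re = 0 := by
      by_cases hfa : f ω = a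
      · have hgb : g ω ≠ b := fun hgb => hω (by simp [hfa, hgb])
        rw [hM.re_inner_eq_zero_of_ne hy hg hgb, mul_zero]
      · rw [hM.re_inner_eq_zero_of_ne hx hf hfa, zero_mul]
    rw [hz] at hle
    exact norm_eq_zero.1 (pow_eq_zero_iff two_ne_zero |>.1 (le_antisymm hle (sq_nonneg _)))
  rw [hxy]
  refine (pow_le_pow_left₀ (norm_nonneg _) (norm_sum_le _ _) 2).trans ?_
  exact Finset.sum_sq_le_sum_mul_sum_of_sq_le_mul _ (fun ω _ => (hM.1 ω x).1)
    (fun ω _ => (hM.1 ω y).1) fun ω _ => norm_inner_map_sq_le (hM.1 ω) x y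

/-- For a perfectly distinguishable pair, the product of all squared overlaps is at most
`(|S^A| |S^B|)^{-|S^A||S^B|}`. -/
theorem prod_overlap_bound_of_distinguishable
    {H : Type*} [NormedAddCommGroup H] [InnerProductSpace ℂ H] [FiniteDimensional ℂ H]
    {KA KB : Type*} [Fintype KA] [Fintype KB]
    (φA : KA → H) (φB : KB → H) (hA : Orthonormal ℂ φA) (hB : Orthonormal ℂ φB)
    (hd : PerfectlyDistinguishable φA φB) :
    ∏ p : KA × KB, ‖⟪φA p.1, φB p.2⟫_ℂ‖ ^ 2
      ≤ (1 / ((Fintype.card KA : ℝ) * (Fintype.card KB : ℝ)))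
          ^ (Fintype.card KA * Fintype.card KB) := by
  obtain ⟨N, M, fA, fB, hM, hfA, hfB⟩ := hd
  let S (a : KA) (b : KB) := Finset.univ.filter fun ω => fA ω = a ∧ fB ω = b
  let P (a : KA) (b : KB) : ℝ := ∑ ω ∈ S a b, (⟪φA a, M ω (φA a)⟫_ℂ).re
  let Q (a : KA) (b : KB) : ℝ := ∑ ω ∈ S a b, (⟪φB b, M ω (φB b)⟫_ℂ).re
  have hP0 : ∀ a b, 0 ≤ P a b := fun a b => Finset.sum_nonneg fun ω _ => (hM.1 ω _).1
  have hQ0 : ∀ a b, 0 ≤ Q a b := fun a b => Finset.sum_nonneg fun ω _ => (hM.1 ω _).1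
  have hP1 : ∀ a, ∑ b, P a b = 1 := fun a => sum_filter_filter_re fA fB a _ (hfA a)
  have hQ1 : ∀ b, ∑ a, Q a b = 1 := fun b => by
    simpa only [Q, S, and_comm] using sum_filter_filter_re fB fA b _ (hfB b)
  have hPprod : ∏ a, ∏ b, P a b ≤
      (1 / (Fintype.card KB : ℝ)) ^ (Fintype.card KA * Fintype.card KB) := by
    refine (Finset.prod_le_prod (fun a _ => Finset.prod_nonneg fun b _ => hP0 a b)
      fun a _ => prod_le_inv_card_pow_of_sum_eq_one (hP0 a) (hP1 a)).trans ?_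
    rw [Finset.prod_const, Finset.card_univ, ← pow_mul, mul_comm]
  have hQprod : ∏ a, ∏ b, Q a b ≤
      (1 / (Fintype.card KA : ℝ)) ^ (Fintype.card KA * Fintype.card KB) := by
    rw [Finset.prod_comm]
    refine (Finset.prod_le_prod (fun b _ => Finset.prod_nonneg fun a _ => hQ0 a b)
      fun b _ => prod_le_inv_card_pow_of_sum_eq_one (fun a => hQ0 a b) (hQ1 b)).trans ?_
    rw [Finset.prod_const, Finset.card_univ, ← pow_mul]
  calc ∏ p : KA × KB, ‖⟪φA p.1, φB p.2⟫_ℂ‖ ^ 2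
      ≤ ∏ p : KA × KB, P p.1 p.2 * Q p.1 p.2 :=
        Finset.prod_le_prod (fun p _ => sq_nonneg _) fun p _ =>
          hM.norm_inner_sq_le (hA.1 p.1) (hB.1 p.2) (hfA p.1) (hfB p.2)
    _ = (∏ a, ∏ b, P a b) * ∏ a, ∏ b, Q a b := by
        rw [Finset.prod_mul_distrib, Fintype.prod_prod_type, Fintype.prod_prod_type]
    _ ≤ (1 / (Fintype.card KB : ℝ)) ^ (Fintype.card KA * Fintype.card KB) *
          (1 / (Fintype.card KA : ℝ)) ^ (Fintype.card KA * Fintype.card KB) :=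
        mul_le_mul hPprod hQprod
          (Finset.prod_nonneg fun a _ => Finset.prod_nonneg fun b _ => hQ0 a b) (by positivity)
    _ = _ := by rw [← mul_pow, one_div_mul_one_div, mul_comm (Fintype.card KB : ℝ)]

end
end

section
/- A 2×2 real matrix P belongs to D(2,2) if and only if all entries of P are strictly positive, P_{11} + P_{12} < 1, and (1−P_{11})(1−P_{22}) + (1−P_{12})(1−P_{21}) − 2·(P_{11}P_{12}P_{21}P_{22})^{1/2} ≥ 1. -/
open scoped Classical

noncomputable section

/-- The stochastic constraints defining `D(2,2)` reduce to this equation on the segment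
`s + t = L`; it is solvable as soon as the minimum of `p / s + q / t` is at most `K`. -/
lemma exists_pos_add_eq_div_add_div_eq {K L p q : ℝ} (hL : 0 < L) (hp : 0 < p) (hq : 0 < q)
    (h : p + q + 2 * Real.sqrt (p * q) ≤ K * L) :
    ∃ s t : ℝ, 0 < s ∧ 0 < t ∧ s + t = L ∧ p / s + q / t = K := by
  have hα : 0 < Real.sqrt p := Real.sqrt_pos.2 hp
  have hβ : 0 < Real.sqrt q := Real.sqrt_pos.2 hq
  have hpα := Real.sq_sqrt hp.le
  have hqβ := Real.sq_sqrt hq.le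
  rw [Real.sqrt_mul hp.le] at h
  set α := Real.sqrt p
  set β := Real.sqrt q
  have hαβ : 0 < α + β := add_pos hα hβ
  let g : ℝ → ℝ := fun s => K * s * (L - s) - p * (L - s) - q * s
  let s₀ : ℝ := L * α / (α + β)
  have hs₀ : 0 < s₀ := by positivity
  have hs₀L : s₀ < L := by
    rw [div_lt_iff₀ hαβ]
    nlinarith [mul_pos hL hβ]
  have hg₀ : g 0 ≤ 0 := by
    have := mul_pos hp hL
    simp only [g]
    linarith
  have hgs₀ : 0 ≤ g s₀ := by
    have key : g s₀ = L * α * β / (α + β) ^ 2 * (K * L - (α + β) ^ 2) := by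
      simp only [g, s₀, ← hpα, ← hqβ]
      field_simp
      ring
    rw [key]
    exact mul_nonneg (by positivity) (by nlinarith)
  have hg : ContinuousOn g (Set.Icc 0 s₀) := by fun_prop
  obtain ⟨s, ⟨hs, hss₀⟩, hgs⟩ := intermediate_value_Icc hs₀.le hg ⟨hg₀, hgs₀⟩
  have hs_pos : 0 < s := by
    refine hs.lt_of_ne' ?_
    rintro rfl
    have := mul_pos hp hL
    simp only [g] at hgs
    linarith
  have ht : 0 < L - s := by linarith
  refine ⟨s, L - s, hs_pos, ht, by ring, ?_⟩
  simp only [g] at hgs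
  rw [div_add_div _ _ hs_pos.ne' ht.ne', div_eq_iff (by positivity)]
  linarith

lemma two_mul_sqrt_mul_le_add {m n : ℝ} (hm : 0 ≤ m) (hn : 0 ≤ n) :
    2 * Real.sqrt (m * n) ≤ m + n := by
  rw [Real.sqrt_mul hm]
  nlinarith [sq_nonneg (Real.sqrt m - Real.sqrt n), Real.sq_sqrt hm, Real.sq_sqrt hn]

/-- Characterization of `D(2,2)`: a `2×2` matrix `P` lies in `D(2,2)` iff all of its
entries are strictly positive, `P₁₁ + P₁₂ < 1`, and
`(1-P₁₁)(1-P₂₂) + (1-P₁₂)(1-P₂₁) - 2√(P₁₁P₁₂P₂₁P₂₂) ≥ 1`. -/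
theorem memD_two_by_two_iff (P : Matrix (Fin 2) (Fin 2) ℝ) :
    MemD P ↔
      (∀ i j, 0 < P i j) ∧ P 0 0 + P 0 1 < 1 ∧
        (1 - P 0 0) * (1 - P 1 1) + (1 - P 0 1) * (1 - P 1 0)
            - 2 * Real.sqrt (P 0 0 * P 0 1 * P 1 0 * P 1 1) ≥ 1 := by
  constructor
  · rintro ⟨⟨A, B, ⟨hA, hA₁⟩, ⟨hB, hB₁⟩, hP⟩, hpos⟩
    refine ⟨hpos, ?_⟩
    have hA₀ := hA₁ 0
    have hA₁ := hA₁ 1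
    have hB₀ := hB₁ 0
    have hB₁ := hB₁ 1
    simp only [Fin.sum_univ_two] at hA₀ hA₁ hB₀ hB₁
    have hApos : ∀ i j, 0 < A i j := fun i j =>
      (hA i j).lt_of_ne' fun h => (hpos i j).ne' (by rw [hP, h, zero_mul])
    have hBpos : ∀ i j, 0 < B i j := fun i j =>
      (hB i j).lt_of_ne' fun h => (hpos i j).ne' (by rw [hP, h, mul_zero])
    have hm : 0 ≤ A 1 0 * B 0 0 * (A 0 1 * B 1 1) :=
      mul_nonneg (mul_nonneg (hA _ _) (hB _ _)) (mul_nonneg (hA _ _) (hB _ _))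
    have hn : 0 ≤ A 1 1 * B 0 1 * (A 0 0 * B 1 0) :=
      mul_nonneg (mul_nonneg (hA _ _) (hB _ _)) (mul_nonneg (hA _ _) (hB _ _))
    have key := two_mul_sqrt_mul_le_add hm hn
    have hprod : A 1 0 * B 0 0 * (A 0 1 * B 1 1) * (A 1 1 * B 0 1 * (A 0 0 * B 1 0)) =
        P 0 0 * P 0 1 * P 1 0 * P 1 1 := by
      simp only [hP]
      ring
    rw [hprod] at key
    have e₀ : A 0 1 = 1 - A 0 0 := by linarith
    have e₁ : A 1 1 = 1 - A 1 0 := by linarith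
    have f₀ : B 1 0 = 1 - B 0 0 := by linarith
    have f₁ : B 1 1 = 1 - B 0 1 := by linarith
    constructor
    · have h₀ := mul_pos (hApos 0 0) (hBpos 1 0)
      have h₁ := mul_pos (hApos 0 1) (hBpos 1 1)
      rw [f₀] at h₀
      rw [f₁] at h₁
      rw [hP, hP]
      linarith
    · suffices (1 - P 0 0) * (1 - P 1 1) + (1 - P 0 1) * (1 - P 1 0) - 1 =
          A 1 0 * B 0 0 * (A 0 1 * B 1 1) + A 1 1 * B 0 1 * (A 0 0 * B 1 0) by linarith
      simp only [hP, e₀, e₁, f₀, f₁]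
      ring
  · rintro ⟨hpos, hrow, h⟩
    have ha := hpos 0 0
    have hb := hpos 0 1
    have hc := hpos 1 0
    have hd := hpos 1 1
    have hprod : P 1 0 * P 0 0 * (P 1 1 * P 0 1) = P 0 0 * P 0 1 * P 1 0 * P 1 1 := by ring
    obtain ⟨s, t, hs, ht, hst, hK⟩ := exists_pos_add_eq_div_add_div_eq
      (K := 1 - P 1 0 - P 1 1) (L := 1 - P 0 0 - P 0 1) (by linarith)
      (mul_pos hc ha) (mul_pos hd hb) (by rw [hprod]; linarith)
    have hsa : 0 < s + P 0 0 := add_pos hs ha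
    have htb : 0 < t + P 0 1 := add_pos ht hb
    refine ⟨⟨!![s + P 0 0, t + P 0 1; P 1 0 * (s + P 0 0) / s, P 1 1 * (t + P 0 1) / t],
      !![P 0 0 / (s + P 0 0), P 0 1 / (t + P 0 1); s / (s + P 0 0), t / (t + P 0 1)],
      ⟨?_, ?_⟩, ⟨?_, ?_⟩, ?_⟩, hpos⟩
    · simp only [Fin.forall_fin_two, Matrix.of_apply, Matrix.cons_val]
      refine ⟨⟨?_, ?_⟩, ?_, ?_⟩ <;> positivity
    · simp only [Fin.forall_fin_two, Fin.sum_univ_two, Matrix.of_apply, Matrix.cons_val]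
      refine ⟨by linarith, ?_⟩
      rw [mul_add, mul_add, add_div, add_div, mul_div_cancel_right₀ _ hs.ne',
        mul_div_cancel_right₀ _ ht.ne']
      linarith
    · simp only [Fin.forall_fin_two, Matrix.of_apply, Matrix.cons_val]
      refine ⟨⟨?_, ?_⟩, ?_, ?_⟩ <;> positivity
    · simp only [Fin.forall_fin_two, Fin.sum_univ_two, Matrix.of_apply, Matrix.cons_val]
      constructor <;> field_simp <;> ring
    · simp only [Fin.forall_fin_two, Matrix.of_apply, Matrix.cons_val]
      refine ⟨⟨?_, ?_⟩, ?_, ?_⟩ <;> field_simp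

end
end

section
/- For any 2×2 real matrix P ∈ D(2,2) and any 2×2 real matrix Q with 0 < Q_{ij} ≤ P_{ij} for all entries (i,j), it holds that Q ∈ D(2,2). -/
open scoped Classical

noncomputable section

/-- Four positive numbers form a matrix in `D(2,2)` as soon as the quadratic obtained by
eliminating all parameters but `x`, the top left entry of the right stochastic factor, has a
suitable zero. -/
lemma memD_of_root {Q : Matrix (Fin 2) (Fin 2) ℝ} (hQ : ∀ i j, 0 < Q i j) {x : ℝ}
    (hpx : Q 0 0 < x) (hxq : x < 1 - Q 0 1)
    (hx : Q 1 0 * x * (1 - x - Q 0 1) + Q 1 1 * (1 - x) * (x - Q 0 0)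
      = (x - Q 0 0) * (1 - x - Q 0 1)) :
    MemD Q := by
  have hp := hQ 0 0
  have hq := hQ 0 1
  have hr := hQ 1 0
  have hs := hQ 1 1
  have hx0 : 0 < x := by linarith
  have hx1 : 0 < 1 - x := by linarith
  have hxp : 0 < x - Q 0 0 := by linarith
  have hxq' : 0 < 1 - x - Q 0 1 := by linarith
  have hb : Q 1 0 * x / (x - Q 0 0) + Q 1 1 * (1 - x) / (1 - x - Q 0 1) = 1 := by
    rw [div_add_div _ _ hxp.ne' hxq'.ne', div_eq_one_iff_eq (by positivity)]
    linarith
  have hc : Q 0 0 / x + (x - Q 0 0) / x = 1 := by field_simp; ring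
  have hd : Q 0 1 / (1 - x) + (1 - x - Q 0 1) / (1 - x) = 1 := by field_simp; ring
  refine ⟨⟨!![x, 1 - x; Q 1 0 * x / (x - Q 0 0), Q 1 1 * (1 - x) / (1 - x - Q 0 1)],
    !![Q 0 0 / x, Q 0 1 / (1 - x); (x - Q 0 0) / x, (1 - x - Q 0 1) / (1 - x)],
    ⟨?_, ?_⟩, ⟨?_, ?_⟩, ?_⟩, hQ⟩
  · simp only [Fin.forall_fin_two]
    refine ⟨⟨hx0.le, hx1.le⟩, ?_, ?_⟩ <;> simp <;> positivity
  · simpa [Fin.forall_fin_two, Fin.sum_univ_two] using hb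
  · simp only [Fin.forall_fin_two]
    refine ⟨⟨?_, ?_⟩, ?_, ?_⟩ <;> simp <;> positivity
  · simpa [Fin.forall_fin_two, Fin.sum_univ_two] using And.intro hc hd
  · simp only [Fin.forall_fin_two]
    refine ⟨⟨?_, ?_⟩, ?_, ?_⟩ <;> simp <;> field_simp

/-- `D(2,2)` is downward closed under the entrywise order within entrywise-positive
matrices. -/
theorem memD_two_by_two_of_le (P Q : Matrix (Fin 2) (Fin 2) ℝ) (hP : MemD P)
    (hQ : ∀ i j, 0 < Q i j ∧ Q i j ≤ P i j) :
    MemD Q := by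
  obtain ⟨⟨A, B, ⟨hA, hA1⟩, ⟨hB, hB1⟩, hAB⟩, hP0⟩ := hP
  simp only [Fin.sum_univ_two] at hA1 hB1
  have hApos : ∀ i j, 0 < A i j := fun i j =>
    (hA i j).lt_of_ne' (left_ne_zero_of_mul (hAB i j ▸ (hP0 i j).ne'))
  have hBpos : ∀ i j, 0 < B i j := fun i j =>
    (hB i j).lt_of_ne' (right_ne_zero_of_mul (hAB i j ▸ (hP0 i j).ne'))
  have hle : ∀ i j, Q i j ≤ A i j * B i j := fun i j => hAB i j ▸ (hQ i j).2
  have hA01 : A 0 1 = 1 - A 0 0 := by linarith [hA1 0]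
  have hp : A 0 0 * B 1 0 ≤ A 0 0 - Q 0 0 := by
    have : A 0 0 * B 0 0 + A 0 0 * B 1 0 = A 0 0 := by rw [← mul_add, hB1, mul_one]
    linarith [hle 0 0]
  have hq : A 0 1 * B 1 1 ≤ A 0 1 - Q 0 1 := by
    have : A 0 1 * B 0 1 + A 0 1 * B 1 1 = A 0 1 := by rw [← mul_add, hB1, mul_one]
    linarith [hle 0 1]
  have hp0 : 0 < A 0 0 - Q 0 0 := (mul_pos (hApos 0 0) (hBpos 1 0)).trans_le hp
  have hq0 : 0 < A 0 1 - Q 0 1 := (mul_pos (hApos 0 1) (hBpos 1 1)).trans_le hq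
  have hr : Q 1 0 * A 0 0 ≤ A 1 0 * (A 0 0 - Q 0 0) := by
    calc Q 1 0 * A 0 0 ≤ A 1 0 * B 1 0 * A 0 0 :=
          mul_le_mul_of_nonneg_right (hle 1 0) (hA 0 0)
      _ = A 1 0 * (A 0 0 * B 1 0) := by ring
      _ ≤ _ := mul_le_mul_of_nonneg_left hp (hA 1 0)
  have hs : Q 1 1 * A 0 1 ≤ A 1 1 * (A 0 1 - Q 0 1) := by
    calc Q 1 1 * A 0 1 ≤ A 1 1 * B 1 1 * A 0 1 :=
          mul_le_mul_of_nonneg_right (hle 1 1) (hA 0 1)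
      _ = A 1 1 * (A 0 1 * B 1 1) := by ring
      _ ≤ _ := mul_le_mul_of_nonneg_left hq (hA 1 1)
  let g : ℝ → ℝ := fun x => (x - Q 0 0) * (1 - x - Q 0 1)
    - (Q 1 0 * x * (1 - x - Q 0 1) + Q 1 1 * (1 - x) * (x - Q 0 0))
  have hg : Continuous g := by fun_prop
  have hg_left : g (Q 0 0) < 0 := by
    have : 0 < Q 1 0 * Q 0 0 * (1 - Q 0 0 - Q 0 1) :=
      mul_pos (mul_pos (hQ 1 0).1 (hQ 0 0).1) (by linarith)
    simp only [g, sub_self, zero_mul, mul_zero]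
    linarith
  have hg_right : 0 ≤ g (A 0 0) := by
    have h1 := mul_le_mul_of_nonneg_right hr hq0.le
    have h2 := mul_le_mul_of_nonneg_right hs hp0.le
    have hA11 : A 1 1 = 1 - A 1 0 := by linarith [hA1 1]
    simp only [hA01, hA11] at h1 h2
    simp only [g]
    linarith
  obtain ⟨x, ⟨hx1, hx2⟩, hx⟩ :=
    intermediate_value_Icc (by linarith : Q 0 0 ≤ A 0 0) hg.continuousOn ⟨hg_left.le, hg_right⟩
  have hne : Q 0 0 ≠ x := by
    rintro rfl
    exact hg_left.ne hx
  exact memD_of_root (fun i j => (hQ i j).1) (hx1.lt_of_ne hne) (by linarith)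
    (sub_eq_zero.mp hx).symm

end
end

section
/- Let n ≥ 2 and m ≥ 2. For any n×m real matrix P ∈ D(n,m) and any n×m real matrix Q with 0 < Q_{ij} ≤ P_{ij} for all entries (i,j), it holds that Q ∈ D(n,m). -/
open scoped Classical

noncomputable section

/-- Lowering one entry of a positive `2 × 2` Hadamard product keeps it factorizable with the same
row sums of the left factor and the same column sums of the right factor. -/
lemma exists_two_by_two_factorization {a₁ a₂ a₃ a₄ b₁ b₂ b₃ b₄ q : ℝ}
    (ha₁ : 0 < a₁) (ha₂ : 0 < a₂) (ha₃ : 0 < a₃) (ha₄ : 0 < a₄)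
    (hb₁ : 0 < b₁) (hb₂ : 0 < b₂) (hb₃ : 0 < b₃) (hb₄ : 0 < b₄)
    (hq : 0 < q) (hqle : q ≤ a₁ * b₁) :
    ∃ c₁ c₂ c₃ c₄ d₁ d₂ d₃ d₄ : ℝ,
      (0 ≤ c₁ ∧ 0 ≤ c₂ ∧ 0 ≤ c₃ ∧ 0 ≤ c₄ ∧ 0 ≤ d₁ ∧ 0 ≤ d₂ ∧ 0 ≤ d₃ ∧ 0 ≤ d₄) ∧
      (c₁ + c₂ = a₁ + a₂ ∧ c₃ + c₄ = a₃ + a₄ ∧ d₁ + d₃ = b₁ + b₃ ∧ d₂ + d₄ = b₂ + b₄) ∧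
      c₁ * d₁ = q ∧ c₂ * d₂ = a₂ * b₂ ∧ c₃ * d₃ = a₃ * b₃ ∧ c₄ * d₄ = a₄ * b₄ := by
  set u := a₁ + a₂ - a₂ * b₂ / (b₂ + b₄) with hu
  have hs : 0 < b₂ + b₄ := by positivity
  have hfrac : a₂ * b₂ / (b₂ + b₄) ≤ a₂ := by
    rw [div_le_iff₀ hs]; nlinarith [mul_pos ha₂ hb₄]
  have hfrac_pos : 0 < a₂ * b₂ / (b₂ + b₄) := by positivity
  have hle : a₁ ≤ u := by linarith
  have hfirst : ∀ t ∈ Set.Icc a₁ u, 0 < t ∧ q / t ≤ b₁ := fun t ht => by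
    have h0 : 0 < t := ha₁.trans_le ht.1
    refine ⟨h0, ?_⟩
    rw [div_le_iff₀ h0]
    nlinarith [ht.1]
  have hsecond : ∀ t ∈ Set.Icc a₁ u, 0 < a₁ + a₂ - t ∧ a₂ * b₂ / (a₁ + a₂ - t) ≤ b₂ + b₄ :=
      fun t ht => by
    have h1 : a₂ * b₂ / (b₂ + b₄) ≤ a₁ + a₂ - t := by linarith [ht.2]
    have h0 : 0 < a₁ + a₂ - t := by linarith
    exact ⟨h0, (div_le_comm₀ hs h0).1 h1⟩
  have hthird : ∀ t ∈ Set.Icc a₁ u, 0 < b₁ + b₃ - q / t ∧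
      a₃ * b₃ / (b₁ + b₃ - q / t) ≤ a₃ := fun t ht => by
    obtain ⟨_, h1⟩ := hfirst t ht
    have h0 : 0 < b₁ + b₃ - q / t := by linarith
    refine ⟨h0, ?_⟩
    rw [div_le_iff₀ h0]
    nlinarith
  let g : ℝ → ℝ := fun t =>
    (a₃ + a₄ - a₃ * b₃ / (b₁ + b₃ - q / t)) * (b₂ + b₄ - a₂ * b₂ / (a₁ + a₂ - t))
  have hg : ContinuousOn g (Set.Icc a₁ u) := by
    have hdiv : ContinuousOn (fun t : ℝ => q / t) (Set.Icc a₁ u) :=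
      continuousOn_const.div continuousOn_id fun t ht => (hfirst t ht).1.ne'
    exact (continuousOn_const.sub (continuousOn_const.div (continuousOn_const.sub hdiv)
      fun t ht => (hthird t ht).1.ne')).mul (continuousOn_const.sub
        (continuousOn_const.div (continuousOn_const.sub continuousOn_id)
          fun t ht => (hsecond t ht).1.ne'))
  have hgu : g u = 0 := by
    have : a₁ + a₂ - u = a₂ * b₂ / (b₂ + b₄) := by rw [hu]; ring
    simp only [g, this]
    rw [div_div_cancel₀ (by positivity), sub_self, mul_zero]
  have hga : a₄ * b₄ ≤ g a₁ := by
    have h2 : a₂ * b₂ / (a₁ + a₂ - a₁) = b₂ := by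
      rw [add_sub_cancel_left, mul_div_cancel_left₀ _ ha₂.ne']
    have h3 := (hthird a₁ ⟨le_rfl, hle⟩).2
    simp only [g, h2]
    nlinarith
  obtain ⟨t, ht, hgt⟩ := intermediate_value_Icc' hle hg
    (show a₄ * b₄ ∈ Set.Icc (g u) (g a₁) from ⟨by rw [hgu]; positivity, hga⟩)
  obtain ⟨h1, h1'⟩ := hfirst t ht
  obtain ⟨h2, h2'⟩ := hsecond t ht
  obtain ⟨h3, h3'⟩ := hthird t ht
  exact ⟨t, a₁ + a₂ - t, a₃ * b₃ / (b₁ + b₃ - q / t),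
    a₃ + a₄ - a₃ * b₃ / (b₁ + b₃ - q / t), q / t, a₂ * b₂ / (a₁ + a₂ - t), b₁ + b₃ - q / t,
    b₂ + b₄ - a₂ * b₂ / (a₁ + a₂ - t),
    ⟨h1.le, h2.le, by positivity, by linarith, by positivity, by positivity, h3.le, by linarith⟩,
    ⟨by ring, by ring, by ring, by ring⟩,
    mul_div_cancel₀ _ h1.ne', mul_div_cancel₀ _ h2.ne', div_mul_cancel₀ _ h3.ne', hgt⟩

/-- Two functions that agree off a pair of points, and whose sums over the pair agree, have the
same sum. -/
lemma sum_eq_sum_of_agree_off_pair {ι : Type*} [Fintype ι] {f g : ι → ℝ} {j k : ι} (hjk : j ≠ k)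
    (hpair : f j + f k = g j + g k) (hoff : ∀ x, x ≠ j → x ≠ k → f x = g x) :
    ∑ x, f x = ∑ x, g x := by
  rw [← sub_eq_zero, ← Finset.sum_sub_distrib,
    Fintype.sum_eq_add j k hjk fun x hx => sub_eq_zero.2 (hoff x hx.1 hx.2)]
  linarith

/-- `D(n,m)` is closed under lowering a single entry. -/
lemma MemD.of_lower_entry {n m : Type*} [Fintype n] [Fintype m] [Nontrivial n] [Nontrivial m]
    {P R : Matrix n m ℝ} (hP : MemD P) (i : n) (j : m) (hpos : 0 < R i j) (hle : R i j ≤ P i j)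
    (hoff : ∀ x y, ¬(x = i ∧ y = j) → R x y = P x y) : MemD R := by
  obtain ⟨⟨A, B, ⟨hA, hA'⟩, ⟨hB, hB'⟩, hAB⟩, hP0⟩ := hP
  obtain ⟨k, hk⟩ := exists_ne i
  obtain ⟨l, hl⟩ := exists_ne j
  have hApos : ∀ x y, 0 < A x y := fun x y =>
    pos_of_mul_pos_left (hAB x y ▸ hP0 x y) (hB x y)
  have hBpos : ∀ x y, 0 < B x y := fun x y =>
    pos_of_mul_pos_right (hAB x y ▸ hP0 x y) (hA x y)
  obtain ⟨c₁, c₂, c₃, c₄, d₁, d₂, d₃, d₄, ⟨hc₁, hc₂, hc₃, hc₄, hd₁, hd₂, hd₃, hd₄⟩,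
      ⟨hr₁, hr₂, hs₁, hs₂⟩, h₁, h₂, h₃, h₄⟩ :=
    exists_two_by_two_factorization (hApos i j) (hApos i l) (hApos k j) (hApos k l)
      (hBpos i j) (hBpos i l) (hBpos k j) (hBpos k l) hpos (hAB i j ▸ hle)
  let C : Matrix n m ℝ := fun x y =>
    if x = i then (if y = j then c₁ else if y = l then c₂ else A x y)
    else if x = k then (if y = j then c₃ else if y = l then c₄ else A x y) else A x y
  let E : Matrix n m ℝ := fun x y =>
    if x = i then (if y = j then d₁ else if y = l then d₂ else B x y)
    else if x = k then (if y = j then d₃ else if y = l then d₄ else B x y) else B x y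
  refine ⟨⟨C, E, ⟨fun x y => ?_, fun x => ?_⟩, ⟨fun x y => ?_, fun y => ?_⟩, fun x y => ?_⟩,
    fun x y => ?_⟩
  · have := hA x y
    simp only [C]
    split_ifs <;> assumption
  · rw [← hA' x]
    refine sum_eq_sum_of_agree_off_pair hl.symm ?_ fun y hyj hyl => by simp [C, hyj, hyl]
    by_cases hxi : x = i
    · subst hxi; simpa [C, hl] using hr₁
    · by_cases hxk : x = k
      · subst hxk; simpa [C, hl, hk] using hr₂
      · simp [C, hxi, hxk]
  · have := hB x y
    simp only [E]
    split_ifs <;> assumption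
  · rw [← hB' y]
    refine sum_eq_sum_of_agree_off_pair hk.symm ?_ fun x hxi hxk => by simp [E, hxi, hxk]
    by_cases hyj : y = j
    · subst hyj; simpa [E, hk] using hs₁
    · by_cases hyl : y = l
      · subst hyl; simpa [E, hl, hk] using hs₂
      · simp [E, hyj, hyl]
  · by_cases hxy : x = i ∧ y = j
    · obtain ⟨rfl, rfl⟩ := hxy
      simp [C, E, h₁]
    · rw [hoff x y hxy, hAB x y]
      simp only [C, E]
      split_ifs <;> simp_all
  · by_cases hxy : x = i ∧ y = j
    · rwa [hxy.1, hxy.2]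
    · rw [hoff x y hxy]
      exact hP0 x y

/-- For `n, m ≥ 2`, the set `D(n,m)` is downward closed under the entrywise order
within entrywise-positive matrices. -/
theorem memD_of_le {n m : ℕ} (hn : 2 ≤ n) (hm : 2 ≤ m)
    (P Q : Matrix (Fin n) (Fin m) ℝ) (hP : MemD P)
    (hQ : ∀ i j, 0 < Q i j ∧ Q i j ≤ P i j) :
    MemD Q := by
  have : Nontrivial (Fin n) := Fin.nontrivial_iff_two_le.2 hn
  have : Nontrivial (Fin m) := Fin.nontrivial_iff_two_le.2 hm
  have key : ∀ S : Finset (Fin n × Fin m),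
      MemD (fun i j => if (i, j) ∈ S then Q i j else P i j : Matrix (Fin n) (Fin m) ℝ) := by
    intro S
    induction S using Finset.induction_on with
    | empty => simpa using hP
    | insert p S hp ih =>
      obtain ⟨i, j⟩ := p
      refine ih.of_lower_entry i j ?_ ?_ fun x y hxy => ?_
      · simpa using (hQ i j).1
      · simpa [hp] using (hQ i j).2
      · simp [hxy]
  simpa using key Finset.univ

end
end

section
/- For all n ≥ 1 and m ≥ 1, the set D̄(n,m) is the topological closure of D(n,m) in the space of n×m real matrices; that is, D̄(n,m) is closed and every element of D̄(n,m) is a limit of elements of D(n,m). -/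
open scoped Classical

noncomputable section

theorem isCompact_rightStochastic {n m : Type*} [Fintype m] :
    IsCompact {A : Matrix n m ℝ | RightStochastic A} := by
  have hK : IsCompact (Set.univ.pi fun _ : n => Set.univ.pi fun _ : m => Set.Icc (0 : ℝ) 1) :=
    isCompact_univ_pi fun _ => isCompact_univ_pi fun _ => isCompact_Icc
  refine IsCompact.of_isClosed_subset (X := n → m → ℝ) hK ?_ ?_
  · have h : {A : n → m → ℝ | RightStochastic A} =
        (⋂ i, ⋂ j, {A | 0 ≤ A i j}) ∩ ⋂ i, {A | ∑ j, A i j = 1} := by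
      ext A
      simp [RightStochastic]
    refine h ▸ IsClosed.inter ?_ ?_
    · exact isClosed_iInter fun i => isClosed_iInter fun j =>
        isClosed_le continuous_const (by fun_prop)
    · exact isClosed_iInter fun i => isClosed_eq (by fun_prop) continuous_const
  · intro A hA i _ j _
    exact ⟨hA.1 i j, hA.2 i ▸
      Finset.single_le_sum (fun k _ => hA.1 i k) (Finset.mem_univ j)⟩

theorem rightStochastic_transpose_iff {n m : Type*} [Fintype n] {B : Matrix n m ℝ} :
    RightStochastic B.transpose ↔ LeftStochastic B :=
  and_congr forall_comm Iff.rfl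

theorem isCompact_leftStochastic {n m : Type*} [Fintype n] :
    IsCompact {B : Matrix n m ℝ | LeftStochastic B} := by
  have h : {B : Matrix n m ℝ | LeftStochastic B} =
      Matrix.transpose '' {A : Matrix m n ℝ | RightStochastic A} := by
    ext B
    constructor
    · exact fun hB => ⟨B.transpose, rightStochastic_transpose_iff.2 hB, B.transpose_transpose⟩
    · rintro ⟨A, hA, rfl⟩
      exact rightStochastic_transpose_iff.1 hA
  exact h ▸ isCompact_rightStochastic.image (continuous_id.matrix_transpose)

theorem isCompact_memDBar {n m : Type*} [Fintype n] [Fintype m] :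
    IsCompact {P : Matrix n m ℝ | MemDBar P} := by
  have h : {P : Matrix n m ℝ | MemDBar P} =
      (fun p : Matrix n m ℝ × Matrix n m ℝ => Matrix.of fun i j => p.1 i j * p.2 i j) ''
        ({A | RightStochastic A} ×ˢ {B | LeftStochastic B}) := by
    ext P
    constructor
    · rintro ⟨A, B, hA, hB, hP⟩
      exact ⟨(A, B), ⟨hA, hB⟩, Matrix.ext fun i j => (hP i j).symm⟩
    · rintro ⟨⟨A, B⟩, ⟨hA, hB⟩, rfl⟩
      exact ⟨A, B, hA, hB, fun _ _ => rfl⟩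
  refine h ▸ (isCompact_rightStochastic.prod isCompact_leftStochastic).image ?_
  exact continuous_matrix fun i j =>
    (continuous_fst.matrix_elem i j).mul (continuous_snd.matrix_elem i j)

/-- The convex combination of a matrix with the constant matrix of value `c`. -/
def mixConst {n m : Type*} (c t : ℝ) (A : Matrix n m ℝ) : Matrix n m ℝ :=
  Matrix.of fun i j => (1 - t) * A i j + t * c

theorem mixConst_pos {n m : Type*} {c t : ℝ} {A : Matrix n m ℝ} (hA : ∀ i j, 0 ≤ A i j)
    (hc : 0 < c) (ht : t ∈ Set.Ioo (0 : ℝ) 1) (i : n) (j : m) : 0 < mixConst c t A i j :=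
  add_pos_of_nonneg_of_pos (mul_nonneg (sub_nonneg.2 ht.2.le) (hA i j)) (mul_pos ht.1 hc)

theorem RightStochastic.mixConst {n m : Type*} [Fintype m] [Nonempty m] {A : Matrix n m ℝ}
    (hA : RightStochastic A) {t : ℝ} (ht : t ∈ Set.Ioo (0 : ℝ) 1) :
    RightStochastic (mixConst (Fintype.card m : ℝ)⁻¹ t A) := by
  have hm : (0 : ℝ) < Fintype.card m := by exact_mod_cast Fintype.card_pos
  refine ⟨fun i j => (mixConst_pos hA.1 (inv_pos.2 hm) ht i j).le, fun i => ?_⟩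
  simp only [_root_.mixConst, Matrix.of_apply, Finset.sum_add_distrib, ← Finset.mul_sum, hA.2 i,
    Finset.sum_const, Finset.card_univ, nsmul_eq_mul]
  field_simp
  ring

theorem LeftStochastic.mixConst {n m : Type*} [Fintype n] [Nonempty n] {B : Matrix n m ℝ}
    (hB : LeftStochastic B) {t : ℝ} (ht : t ∈ Set.Ioo (0 : ℝ) 1) :
    LeftStochastic (mixConst (Fintype.card n : ℝ)⁻¹ t B) :=
  rightStochastic_transpose_iff.1 ((rightStochastic_transpose_iff.2 hB).mixConst ht)

theorem MemDBar.mem_closure {n m : Type*} [Fintype n] [Fintype m] [Nonempty n] [Nonempty m]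
    {P : Matrix n m ℝ} (hP : MemDBar P) : P ∈ closure {Q : Matrix n m ℝ | MemD Q} := by
  obtain ⟨A, B, hA, hB, hP⟩ := hP
  let a : ℝ := (Fintype.card m : ℝ)⁻¹
  let b : ℝ := (Fintype.card n : ℝ)⁻¹
  have ha : 0 < a := inv_pos.2 (by exact_mod_cast Fintype.card_pos)
  have hb : 0 < b := inv_pos.2 (by exact_mod_cast Fintype.card_pos)
  let f : ℝ → Matrix n m ℝ := fun t => Matrix.of fun i j => mixConst a t A i j * mixConst b t B i j
  have hf : Continuous f := continuous_matrix fun i j => by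
    simp only [f, mixConst, Matrix.of_apply]
    fun_prop
  have hf0 : f 0 = P := by
    ext i j
    simp [f, mixConst, hP]
  have h0 : (0 : ℝ) ∈ closure (Set.Ioo (0 : ℝ) 1) := by
    rw [closure_Ioo zero_ne_one]
    exact ⟨le_rfl, zero_le_one⟩
  refine hf0 ▸ map_mem_closure hf h0 fun t ht => ⟨⟨_, _, hA.mixConst ht, hB.mixConst ht,
    fun _ _ => rfl⟩, fun i j => ?_⟩
  exact mul_pos (mixConst_pos hA.1 ha ht i j) (mixConst_pos hB.1 hb ht i j)

/-- `D̄(n,m)` is the topological closure of `D(n,m)`: it is closed, and the closure of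
`D(n,m)` equals `D̄(n,m)`. -/
theorem dbar_is_closure_of_d {n m : ℕ} (hn : 1 ≤ n) (hm : 1 ≤ m) :
    IsClosed {P : Matrix (Fin n) (Fin m) ℝ | MemDBar P} ∧
      closure {P : Matrix (Fin n) (Fin m) ℝ | MemD P}
        = {P : Matrix (Fin n) (Fin m) ℝ | MemDBar P} := by
  have hc : IsClosed {P : Matrix (Fin n) (Fin m) ℝ | MemDBar P} := isCompact_memDBar.isClosed
  have : Nonempty (Fin n) := ⟨⟨0, hn⟩⟩
  have : Nonempty (Fin m) := ⟨⟨0, hm⟩⟩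
  exact ⟨hc, (closure_minimal (fun _ hP => hP.1) hc).antisymm fun _ hP => hP.mem_closure⟩

end
end

section
/- Let (S^A, S^B) be a pair of finite orthonormal families of vectors in a finite-dimensional complex inner product space H. There exist a finite set Ω, a POVM (M_ω)_{ω∈Ω}, and conditional probability distributions p^A(·|ω) on K_A and p^B(·|ω) on K_B such that ∑_{ω∈Ω} p^A(a|ω)⟨φ^A_a, M_ω φ^A_a⟩ = 1 for all a ∈ K_A and ∑_{ω∈Ω} p^B(b|ω)⟨φ^B_b, M_ω φ^B_b⟩ = 1 for all b ∈ K_B, if and only if (S^A, S^B) is perfectly distinguishable by post-processing (i.e., with deterministic post-processing functions). -/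
open scoped Classical

noncomputable section

section Helpers

variable {H : Type*} [NormedAddCommGroup H] [InnerProductSpace ℂ H]

theorem IsPOVM.comp_equiv {Ω Λ : Type*} [Fintype Ω] [Fintype Λ] {M : Ω → H →ₗ[ℂ] H}
    (hM : IsPOVM M) (e : Λ ≃ Ω) : IsPOVM (M ∘ e) :=
  ⟨fun ω x => hM.1 (e ω) x, (e.sum_comp M).trans hM.2⟩

/-- Splitting each element of a POVM according to a conditional probability distribution
gives a POVM. -/
theorem IsPOVM.refine {Ω K : Type*} [Fintype Ω] [Fintype K] {M : Ω → H →ₗ[ℂ] H}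
    (hM : IsPOVM M) {p : Ω → K → ℝ} (hp : ∀ ω k, 0 ≤ p ω k) (hp1 : ∀ ω, ∑ k, p ω k = 1) :
    IsPOVM fun x : Ω × K => (p x.1 x.2 : ℂ) • M x.1 := by
  refine ⟨fun x v => ?_, ?_⟩
  · simp only [LinearMap.smul_apply, inner_smul_right, Complex.re_ofReal_mul,
      Complex.im_ofReal_mul, (hM.1 x.1 v).2, mul_zero, and_true]
    exact mul_nonneg (hp _ _) (hM.1 x.1 v).1
  · simp only [Fintype.sum_prod_type, ← Finset.sum_smul, ← Complex.ofReal_sum, hp1,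
      Complex.ofReal_one, one_smul, hM.2]

/-- The index set of the POVM may be any finite type. -/
theorem PerfectlyDistinguishable.of_fintype {KA KB Ω : Type*} [Fintype KA] [Fintype KB]
    [Fintype Ω] {φA : KA → H} {φB : KB → H} {M : Ω → H →ₗ[ℂ] H} (hM : IsPOVM M)
    (fA : Ω → KA) (fB : Ω → KB)
    (hA : ∀ a, (∑ ω, if fA ω = a then ⟪φA a, M ω (φA a)⟫_ℂ else 0) = 1)
    (hB : ∀ b, (∑ ω, if fB ω = b then ⟪φB b, M ω (φB b)⟫_ℂ else 0) = 1) :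
    PerfectlyDistinguishable φA φB := by
  let e := (Fintype.equivFin Ω).symm
  refine ⟨Fintype.card Ω, M ∘ e, fA ∘ e, fB ∘ e, hM.comp_equiv e, fun a => ?_, fun b => ?_⟩
  · rw [Finset.sum_filter, ← hA a, ← e.sum_comp]
    rfl
  · rw [Finset.sum_filter, ← hB b, ← e.sum_comp]
    rfl

end Helpers

/-- Probabilistic post-processing does not change the perfect-distinguishability
condition: a POVM with probabilistic post-processing achieving perfect identification
exists iff the pair is perfectly distinguishable with deterministic post-processing. -/
theorem probabilistic_postprocessing_iff
    {H : Type*} [NormedAddCommGroup H] [InnerProductSpace ℂ H] [FiniteDimensional ℂ H]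
    {KA KB : Type*} [Fintype KA] [Fintype KB]
    (φA : KA → H) (φB : KB → H) (hA : Orthonormal ℂ φA) (hB : Orthonormal ℂ φB) :
    (∃ (N : ℕ) (M : Fin N → H →ₗ[ℂ] H) (pA : Fin N → KA → ℝ) (pB : Fin N → KB → ℝ),
      IsPOVM M ∧
      (∀ ω a, 0 ≤ pA ω a) ∧ (∀ ω, ∑ a, pA ω a = 1) ∧
      (∀ ω b, 0 ≤ pB ω b) ∧ (∀ ω, ∑ b, pB ω b = 1) ∧
      (∀ a, ∑ ω, (pA ω a : ℂ) * ⟪φA a, M ω (φA a)⟫_ℂ = 1) ∧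
      (∀ b, ∑ ω, (pB ω b : ℂ) * ⟪φB b, M ω (φB b)⟫_ℂ = 1)) ↔
    PerfectlyDistinguishable φA φB := by
  constructor
  · rintro ⟨N, M, pA, pB, hM, hpA, hpA1, hpB, hpB1, hA1, hB1⟩
    have hAB : IsPOVM fun x : (Fin N × KA) × KB =>
        (pB x.1.1 x.2 : ℂ) • (pA x.1.1 x.1.2 : ℂ) • M x.1.1 :=
      (hM.refine hpA hpA1).refine (p := fun x => pB x.1) (fun x => hpB x.1) (fun x => hpB1 x.1)
    refine .of_fintype hAB (fun x => x.1.2) (fun x => x.2) (fun a => ?_) (fun b => ?_)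
    · rw [← hA1 a]
      simp only [Fintype.sum_prod_type, LinearMap.smul_apply, inner_smul_right]
      refine Finset.sum_congr rfl fun ω _ => ?_
      rw [Finset.sum_comm]
      simp [← Finset.sum_mul, ← Complex.ofReal_sum, hpB1]
    · rw [← hB1 b]
      simp only [Fintype.sum_prod_type, LinearMap.smul_apply, inner_smul_right]
      refine Finset.sum_congr rfl fun ω _ => ?_
      simp [← Finset.mul_sum, ← Finset.sum_mul, ← Complex.ofReal_sum, hpA1]
  · rintro ⟨N, M, fA, fB, hM, hA1, hB1⟩
    refine ⟨N, M, fun ω a => if fA ω = a then 1 else 0, fun ω b => if fB ω = b then 1 else 0,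
      hM, fun ω a => ?_, fun ω => ?_, fun ω b => ?_, fun ω => ?_, fun a => ?_, fun b => ?_⟩
    · positivity
    · simp
    · positivity
    · simp
    · simpa [Finset.sum_filter, apply_ite Complex.ofReal] using hA1 a
    · simpa [Finset.sum_filter, apply_ite Complex.ofReal] using hB1 b

end
end

section
/- Let (S^A, S^B) be a pair of finite orthonormal families of vectors in a finite-dimensional complex inner product space H, and let (M_{ab})_{(a,b)∈K_A×K_B} be a POVM on H. Then the conditions (i) ∑_{b∈K_B} ⟨φ^A_a, M_{ab} φ^A_a⟩ = 1 for all a ∈ K_A and ∑_{a∈K_A} ⟨φ^B_b, M_{ab} φ^B_b⟩ = 1 for all b ∈ K_B, and (ii) M_{ab} φ^A_{a'} = 0 for all a' ≠ a and all b, and M_{ab} φ^B_{b'} = 0 for all b' ≠ b and all a, are equivalent. -/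
open scoped Classical

noncomputable section

/-- A positive operator annihilates every vector on which its quadratic form vanishes. -/
theorem LinearMap.IsPositive.inner_self_eq_zero_iff {H : Type*} [NormedAddCommGroup H]
    [InnerProductSpace ℂ H] {T : H →ₗ[ℂ] H} (hT : T.IsPositive) (x : H) :
    ⟪x, T x⟫_ℂ = 0 ↔ T x = 0 := by
  refine ⟨fun h => ?_, fun h => by rw [h, inner_zero_right]⟩
  have hq : ∀ t : ℝ,
      0 ≤ (⟪T x, T (T x)⟫_ℂ).re * (t * t) + (2 * ‖T x‖ ^ 2) * t + 0 := by
    intro t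
    have hpos := hT.re_inner_nonneg_right (x + (t : ℂ) • T x)
    have hsymm : ⟪x, T (T x)⟫_ℂ = ⟪T x, T x⟫_ℂ := (hT.isSymmetric x (T x)).symm
    have hnorm : ⟪T x, T x⟫_ℂ = ((‖T x‖ ^ 2 : ℝ) : ℂ) := by
      rw [inner_self_eq_norm_sq_to_K]; simp
    simp only [map_add, map_smul, inner_add_left, inner_add_right, inner_smul_left,
      inner_smul_right, h, hsymm, hnorm, Complex.conj_ofReal, RCLike.re_eq_complex_re,
      Complex.add_re, Complex.re_ofReal_mul, Complex.ofReal_re, Complex.zero_re] at hpos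
    linarith
  have hd := discrim_le_zero hq
  have hn : ‖T x‖ ^ 2 = 0 := by
    rw [discrim] at hd
    nlinarith [sq_nonneg (‖T x‖ ^ 2)]
  simpa using hn

namespace IsPOVM

variable {H : Type*} [NormedAddCommGroup H] [InnerProductSpace ℂ H] {Ω : Type*} [Fintype Ω]
  {M : Ω → H →ₗ[ℂ] H}

theorem isPositive_s14 (hM : IsPOVM M) (ω : Ω) : (M ω).IsPositive := by
  rw [LinearMap.isPositive_iff_complex]
  intro x
  obtain ⟨hre, him⟩ := hM.1 ω x
  rw [← inner_conj_symm (M ω x) x]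
  refine ⟨?_, by simpa only [RCLike.re_eq_complex_re, Complex.conj_re] using hre⟩
  apply Complex.ext
  · rw [Complex.ofReal_re, RCLike.re_eq_complex_re]
  · rw [Complex.ofReal_im, Complex.conj_im, him, neg_zero]

/-- The total probability of the outcomes in `s` on a unit vector `v` is one exactly when all
other effects annihilate `v`. -/
theorem sum_inner_eq_one_iff (hM : IsPOVM M) {v : H} (hv : ‖v‖ = 1) (s : Finset Ω) :
    ∑ ω ∈ s, ⟪v, M ω v⟫_ℂ = 1 ↔ ∀ ω ∉ s, M ω v = 0 := by
  have htotal : ∑ ω ∈ s, ⟪v, M ω v⟫_ℂ + ∑ ω ∈ sᶜ, ⟪v, M ω v⟫_ℂ = 1 := by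
    rw [Finset.sum_add_sum_compl, ← inner_sum, ← LinearMap.sum_apply, hM.2, LinearMap.id_apply,
      inner_self_eq_norm_sq_to_K, hv]
    simp
  have hcompl : ∑ ω ∈ sᶜ, ⟪v, M ω v⟫_ℂ = 0 ↔ ∀ ω ∉ s, M ω v = 0 := by
    open scoped ComplexOrder in
    rw [Finset.sum_eq_zero_iff_of_nonneg fun ω _ => (hM.isPositive_s14 ω).inner_nonneg_right v]
    simp only [Finset.mem_compl, (hM.isPositive_s14 _).inner_self_eq_zero_iff]
  rw [← hcompl, ← htotal, left_eq_add]

/-- The version of `IsPOVM.sum_inner_eq_one_iff` for the outcomes in the range of an embedding. -/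
theorem sum_inner_embedding_eq_one_iff (hM : IsPOVM M) {v : H} (hv : ‖v‖ = 1) {ι : Type*}
    [Fintype ι] (e : ι ↪ Ω) :
    ∑ i, ⟪v, M (e i) v⟫_ℂ = 1 ↔ ∀ ω ∉ Set.range e, M ω v = 0 := by
  simpa using hM.sum_inner_eq_one_iff hv (Finset.univ.map e)

end IsPOVM

/-- Equivalence of the two forms of the measurement-table condition:
the "marginal sums equal one" condition and the kernel condition. -/
theorem measurement_table_conditions_equiv
    {H : Type*} [NormedAddCommGroup H] [InnerProductSpace ℂ H] [FiniteDimensional ℂ H]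
    {KA KB : Type*} [Fintype KA] [Fintype KB]
    (φA : KA → H) (φB : KB → H) (hA : Orthonormal ℂ φA) (hB : Orthonormal ℂ φB)
    (M : KA × KB → H →ₗ[ℂ] H) (hM : IsPOVM M) :
    ((∀ a, ∑ b, ⟪φA a, M (a, b) (φA a)⟫_ℂ = 1) ∧
      (∀ b, ∑ a, ⟪φB b, M (a, b) (φB b)⟫_ℂ = 1)) ↔
    ((∀ a a' b, a' ≠ a → M (a, b) (φA a') = 0) ∧
      (∀ b b' a, b' ≠ b → M (a, b) (φB b') = 0)) := by
  have hrow (a : KA) : ∑ b, ⟪φA a, M (a, b) (φA a)⟫_ℂ = 1 ↔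
      ∀ a' b, a ≠ a' → M (a', b) (φA a) = 0 := by
    simpa using hM.sum_inner_embedding_eq_one_iff (hA.1 a) (Function.Embedding.sectR a KB)
  have hcol (b : KB) : ∑ a, ⟪φB b, M (a, b) (φB b)⟫_ℂ = 1 ↔
      ∀ a b', b ≠ b' → M (a, b') (φB b) = 0 := by
    simpa using hM.sum_inner_embedding_eq_one_iff (hB.1 b) (Function.Embedding.sectL KA b)
  simp only [hrow, hcol]
  exact and_congr ⟨fun h a a' b => h a' a b, fun h a a' b => h a' a b⟩
    ⟨fun h b b' a => h b' a b, fun h b a b' => h b' b a⟩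

end
end

section
/- Let (S^A, S^B) be a pair of finite orthonormal families of vectors in a finite-dimensional complex inner product space H such that the matrix P with entries P_{ab} = |⟨φ^A_a, φ^B_b⟩|² belongs to D̄(|S^A|, |S^B|). Then there exists a standard pair (Φ^A_a)_{a∈K_A}, (Φ^B_b)_{b∈K_B} in ℂ^{K_A×K_B} such that ⟨Φ^A_a, Φ^B_b⟩ = ⟨φ^A_a, φ^B_b⟩ for all (a,b) ∈ K_A × K_B. -/
open scoped Classical

noncomputable section

theorem inner_sum_smul_single {KA KB : Type*} [Fintype KA] [Fintype KB]
    (α β : KA → KB → ℂ) (a : KA) (b : KB) :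
    ⟪∑ b', α a b' • EuclideanSpace.single (a, b') (1 : ℂ),
      ∑ a', β a' b • EuclideanSpace.single (a', b) (1 : ℂ)⟫_ℂ =
      starRingEnd ℂ (α a b) * β a b := by
  simp only [sum_inner, inner_sum, inner_smul_left, inner_smul_right,
    EuclideanSpace.inner_single_left, PiLp.single_apply, Prod.mk.injEq, map_one, one_mul]
  rw [Finset.sum_eq_single a, Finset.sum_eq_single b]
  · simp [mul_comm]
  · intro b' _ h
    simp [h]
  · simp
  · intro a' _ h
    simp [h.symm]
  · simp

/-- "3 ⇒ 2" of the main theorem: if the squared-overlap matrix lies in `D̄`, then there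
is a standard pair with exactly the same overlaps. -/
theorem exists_standard_pair_of_memDBar
    {H : Type*} [NormedAddCommGroup H] [InnerProductSpace ℂ H] [FiniteDimensional ℂ H]
    {KA KB : Type*} [Fintype KA] [Fintype KB]
    (φA : KA → H) (φB : KB → H) (hA : Orthonormal ℂ φA) (hB : Orthonormal ℂ φB)
    (hP : MemDBar (Matrix.of fun a b => ‖⟪φA a, φB b⟫_ℂ‖ ^ 2)) :
    ∃ (ΦA : KA → EuclideanSpace ℂ (KA × KB)) (ΦB : KB → EuclideanSpace ℂ (KA × KB)),
      IsStandardPair ΦA ΦB ∧ ∀ a b, ⟪ΦA a, ΦB b⟫_ℂ = ⟪φA a, φB b⟫_ℂ := by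
  obtain ⟨A, B, ⟨hA0, hA1⟩, ⟨hB0, hB1⟩, hAB⟩ := hP
  let α : KA → KB → ℂ := fun a b => (√(A a b) : ℝ)
  let β : KA → KB → ℂ := fun a b =>
    (√(B a b) : ℝ) * Complex.exp (Complex.arg ⟪φA a, φB b⟫_ℂ * Complex.I)
  have hα (a : KA) (b : KB) : ‖α a b‖ ^ 2 = A a b := by
    simp [α, Complex.norm_real, Real.sq_sqrt (hA0 a b)]
  have hβ (a : KA) (b : KB) : ‖β a b‖ ^ 2 = B a b := by
    simp [β, Complex.norm_real, Complex.norm_exp_ofReal_mul_I, Real.sq_sqrt (hB0 a b)]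
  refine ⟨_, _, ⟨α, β, fun a => ?_, fun b => ?_, fun _ => rfl, fun _ => rfl⟩, fun a b => ?_⟩
  · simpa only [hα] using hA1 a
  · simpa only [hβ] using hB1 b
  · have hsqrt : √(A a b) * √(B a b) = ‖⟪φA a, φB b⟫_ℂ‖ := by
      rw [← Real.sqrt_mul (hA0 a b), ← hAB a b, Matrix.of_apply, Real.sqrt_sq (norm_nonneg _)]
    rw [inner_sum_smul_single]
    simp only [α, β, Complex.conj_ofReal]
    rw [← mul_assoc, ← Complex.ofReal_mul, hsqrt, Complex.norm_mul_exp_arg_mul_I]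

end
end

section
/- Let (S^A, S^B) be a pair of finite orthonormal families of vectors in a finite-dimensional complex inner product space H, and suppose it is perfectly distinguishable by a measurement table (M_{ab})_{(a,b)∈K_A×K_B} in which every operator M_{ab} has rank at most 1, say M_{ab} = |ψ̃_{ab}⟩⟨ψ̃_{ab}| for (possibly unnormalized) vectors ψ̃_{ab} ∈ H. Then the linear map V = ∑_{(a,b)∈K_A×K_B} e_{ab} ⟨ψ̃_{ab}, ·⟩ from H to ℂ^{K_A×K_B} restricts to a linear isometry on span(S^A ∪ S^B), and the families (V φ^A_a)_{a∈K_A}, (V φ^B_b)_{b∈K_B} form a standard pair. -/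
open scoped Classical

noncomputable section

/-- A vector whose mass is carried by the range of an injection `e` is the combination
of the corresponding standard basis vectors. -/
theorem eq_sum_single_of_sum_norm_sq_eq {ι κ : Type*} [Fintype ι] [Fintype κ] [DecidableEq κ]
    (v : EuclideanSpace ℂ κ) (e : ι → κ) (he : Function.Injective e)
    (h : ∑ i, ‖v (e i)‖ ^ 2 = ‖v‖ ^ 2) :
    v = ∑ i, v (e i) • EuclideanSpace.single (e i) (1 : ℂ) := by
  have hzero : ∀ k, k ∉ Set.range e → v k = 0 := by
    intro k hk
    have hsum : ∑ j ∈ insert k (Finset.univ.image e), ‖v j‖ ^ 2 ≤ ∑ j, ‖v j‖ ^ 2 :=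
      Finset.sum_le_univ_sum_of_nonneg fun j => sq_nonneg _
    rw [Finset.sum_insert (by simpa using hk), Finset.sum_image he.injOn, h,
      EuclideanSpace.norm_sq_eq] at hsum
    have hk0 : ‖v k‖ ^ 2 = 0 := le_antisymm (by linarith) (sq_nonneg _)
    simpa using hk0
  ext k
  simp only [WithLp.ofLp_sum, WithLp.ofLp_smul, Finset.sum_apply, Pi.smul_apply,
    PiLp.single_apply, smul_eq_mul, mul_ite, mul_one, mul_zero]
  by_cases hk : k ∈ Set.range e
  · obtain ⟨i, rfl⟩ := hk
    simp [he.eq_iff]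
  · rw [hzero k hk, Finset.sum_eq_zero]
    intro i _
    exact if_neg fun hki => hk ⟨i, hki.symm⟩

/-- Naimark-type extension for rank-one measurement tables: if a measurement table
consists of rank-at-most-one operators `M_{ab} = |ψ̃_{ab}⟩⟨ψ̃_{ab}|`, then the map
`V = ∑ e_{ab}⟨ψ̃_{ab}, ·⟩` preserves inner products on the span of the two families and
sends them to a standard pair. -/
theorem rank_one_table_gives_standard_pair
    {H : Type*} [NormedAddCommGroup H] [InnerProductSpace ℂ H] [FiniteDimensional ℂ H]
    {KA KB : Type*} [Fintype KA] [Fintype KB]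
    (φA : KA → H) (φB : KB → H) (hA : Orthonormal ℂ φA) (hB : Orthonormal ℂ φB)
    (ψ : KA × KB → H) (M : KA × KB → H →ₗ[ℂ] H)
    (hM : ∀ p x, M p x = ⟪ψ p, x⟫_ℂ • ψ p)
    (hMT : IsMeasurementTable φA φB M)
    (V : H →ₗ[ℂ] EuclideanSpace ℂ (KA × KB))
    (hV : ∀ x p, V x p = ⟪ψ p, x⟫_ℂ) :
    (∀ x ∈ Submodule.span ℂ (Set.range φA ∪ Set.range φB),
      ∀ y ∈ Submodule.span ℂ (Set.range φA ∪ Set.range φB),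
        ⟪V x, V y⟫_ℂ = ⟪x, y⟫_ℂ) ∧
    IsStandardPair (fun a => V (φA a)) (fun b => V (φB b)) := by
  have hiso : ∀ x y, ⟪V x, V y⟫_ℂ = ⟪x, y⟫_ℂ := by
    intro x y
    have hy : ∑ p, M p y = y := by
      simpa using LinearMap.congr_fun hMT.1.2 y
    conv_rhs => rw [← hy, inner_sum]
    simp only [PiLp.inner_apply, hV, hM, inner_smul_right, RCLike.inner_apply, inner_conj_symm]
  have hnorm : ∀ x, ‖V x‖ = ‖x‖ := by
    intro x
    have h := hiso x x
    rw [inner_self_eq_norm_sq_to_K, inner_self_eq_norm_sq_to_K] at h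
    exact (sq_eq_sq₀ (norm_nonneg _) (norm_nonneg _)).mp (by exact_mod_cast h)
  have hterm : ∀ x p, ⟪x, M p x⟫_ℂ = ((‖V x p‖ ^ 2 : ℝ) : ℂ) := by
    intro x p
    rw [hM, hV, inner_smul_right, ← inner_conj_symm x, RCLike.mul_conj]
    norm_cast
  have hrow : ∀ a, ∑ b, ‖V (φA a) (a, b)‖ ^ 2 = 1 := by
    intro a
    have h := hMT.2.1 a
    simp only [hterm] at h
    exact_mod_cast h
  have hcol : ∀ b, ∑ a, ‖V (φB b) (a, b)‖ ^ 2 = 1 := by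
    intro b
    have h := hMT.2.2 b
    simp only [hterm] at h
    exact_mod_cast h
  refine ⟨fun x _ y _ => hiso x y, fun a b => V (φA a) (a, b), fun a b => V (φB b) (a, b),
    hrow, hcol, fun a => ?_, fun b => ?_⟩
  · exact eq_sum_single_of_sum_norm_sq_eq _ (fun b => (a, b)) (Prod.mk_right_injective a)
      (by rw [hrow, hnorm, hA.1, one_pow])
  · exact eq_sum_single_of_sum_norm_sq_eq _ (fun a => (a, b)) (Prod.mk_left_injective b)
      (by rw [hcol, hnorm, hB.1, one_pow])

end
end
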